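/- arXiv:1410.5105 — 2 statements merged into one kernel-verified Lean document; each statement's English description precedes it below -/
import Mathlib

section
/- Rounding guarantee for edge-deletion 2-route node-multicut: there is an absolute constant C > 0 such that the following holds. Let G=(V,E) be a finite undirected graph with nonnegative edge costs c_e and source-sink pairs (s_1,t_1),…,(s_r,t_r). Let x : E → [0,∞) and y^1,…,y^r : V → [0,∞) satisfy: for every i and every simple s_i–t_i path P in G, Σ_{e∈E(P)} x_e + Σ_{v∈V(P)} y^i_v ≥ 1; Σ_v y^i_v ≤ 1 for every i; and y^i_{s_i} = y^i_{t_i} = 0 for every i. Then there exists F ⊆ E with Σ_{e∈F} c_e ≤ C · ln(r+1) · ln ln(e(r+1)) · Σ_e c_e x_e such that for every i there do not exist two internally vertex-disjoint s_i–t_i paths in (V, E\F). -/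
open MeasureTheory Filter Topology

lemma rg_aux (V : ℝ → ℝ) (hV : Monotone V) (β W M : ℝ) (hβ0 : 0 < β) (hβ : ∀ ρ, β ≤ V ρ)
    (hW : 2 * β < W) (A : Set ℝ) (hA : MeasurableSet A) (hA01 : A ⊆ Set.Ioo 0 1)
    (hvol : ENNReal.ofReal (1/4) ≤ volume A) (hVA : ∀ ρ ∈ A, V ρ < W / 2) (cut : ℝ → ℝ)
    (hcut : ∀ ρ ∈ A, ∀ᶠ σ in 𝓝[>] ρ, cut ρ * (σ - ρ) ≤ V σ - V ρ)
    (hM : 4 * Real.log (Real.log (W / β) / Real.log 2) < M) :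
    ∃ ρ ∈ A, cut ρ ≤ M * (V ρ * Real.log (W / V ρ)) := by
  by_contra! hcon
  have hWpos : 0 < W := by linarith
  have hlog2 : 0 < Real.log 2 := Real.log_pos (by norm_num)
  set g : ℝ → ℝ := fun v => - Real.log (Real.log (W / v)) with hg
  have hlogpos : ∀ v, 0 < v → v ≤ W / 2 → Real.log 2 ≤ Real.log (W / v) := by
    intro v hv hv2
    apply Real.log_le_log (by norm_num)
    rw [le_div_iff₀ hv]; linarith
  have hgm : ∀ u v, 0 < u → u ≤ v → v ≤ W / 2 → g u ≤ g v := by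
    intro u v hu huv hv
    have h1 := hlogpos v (by linarith) hv
    simp only [hg, neg_le_neg_iff]
    apply Real.log_le_log (by linarith)
    apply Real.log_le_log (by apply div_pos <;> linarith)
    gcongr
  set h : ℝ → ℝ := fun ρ => g (min (V ρ) (W / 2)) with hh
  have hmono : Monotone h := by
    intro a b hab
    apply hgm
    · exact lt_min (lt_of_lt_of_le hβ0 (hβ a)) (by linarith)
    · exact min_le_min (hV hab) le_rfl
    · exact min_le_right _ _
  have hint := MonotoneOn.intervalIntegrable_deriv (f := h) (a := 0) (b := 1) (hmono.monotoneOn _)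
  have hmem := MonotoneOn.intervalIntegral_deriv_mem_uIcc (f := h) (a := 0) (b := 1) (hmono.monotoneOn _)
  have hle01 : h 0 ≤ h 1 := hmono (by norm_num)
  rw [Set.uIcc_of_le (by linarith)] at hmem
  have hup : h 1 - h 0 ≤ Real.log (Real.log (W / β) / Real.log 2) := by
    have e1 : h 1 ≤ g (W / 2) := hgm _ _ (lt_min (lt_of_lt_of_le hβ0 (hβ 1)) (by linarith)) (min_le_right _ _) le_rfl
    have e0 : g β ≤ h 0 := hgm _ _ hβ0 (le_min (hβ 0) (by linarith)) (min_le_right _ _)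
    have : g (W / 2) = - Real.log (Real.log 2) := by
      simp only [hg]; congr 3; field_simp
    have h3 := hlogpos β hβ0 (by linarith)
    rw [Real.log_div (by linarith) (by linarith)]
    simp only [hg] at e0 e1 this
    linarith
  -- derivative lower bound on A
  have hder : ∀ᵐ ρ, ρ ∈ A → M ≤ deriv h ρ := by
    filter_upwards [hV.ae_differentiableAt] with ρ hd hρ
    have hv0 : 0 < V ρ := lt_of_lt_of_le hβ0 (hβ ρ)
    have hl := hlogpos (V ρ) hv0 (hVA ρ hρ).le
    have hd' := hd.hasDerivAt
    have hslope : cut ρ ≤ deriv V ρ := by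
      have ht : Tendsto (slope V ρ) (𝓝[>] ρ) (𝓝 (deriv V ρ)) :=
        (hasDerivAt_iff_tendsto_slope.1 hd').mono_left
          (nhdsWithin_mono _ (fun z hz => ne_of_gt hz))
      refine ge_of_tendsto ht ?_
      filter_upwards [hcut ρ hρ, self_mem_nhdsWithin] with σ h1 h2
      have : 0 < σ - ρ := sub_pos.2 h2
      rw [slope_def_field, le_div_iff₀ this]; exact h1
    have hev : h =ᶠ[𝓝 ρ] fun σ => g (V σ) := by
      have : ∀ᶠ σ in 𝓝 ρ, V σ < W / 2 := hd.continuousAt.eventually_lt continuousAt_const (hVA ρ hρ)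
      filter_upwards [this] with σ hσ
      simp only [hh, min_eq_left hσ.le]
    have hgd : HasDerivAt (fun σ => g (V σ)) (deriv V ρ / (V ρ * Real.log (W / V ρ))) ρ := by
      have h1 : HasDerivAt (fun σ => W / V σ) (-(W * deriv V ρ) / (V ρ)^2) ρ := by
        have := (hasDerivAt_const ρ W).fun_div hd' hv0.ne'
        rwa [zero_mul, zero_sub] at this
      have h2 := (h1.log (by positivity)).log (by linarith)
      have h3 := h2.fun_neg
      refine h3.congr_deriv ?_
      have : Real.log (W / V ρ) ≠ 0 := by linarith
      field_simp
    rw [hev.deriv_eq, hgd.deriv, le_div_iff₀ (by apply mul_pos <;> linarith)]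
    exact (hcon ρ hρ).le.trans hslope
  have hintA : M * (1/4) ≤ ∫ ρ in A, deriv h ρ := by
    have hfin : volume A ≠ ⊤ := by
      refine ne_top_of_le_ne_top ?_ (measure_mono hA01)
      simp
    have hi : IntegrableOn (deriv h) A := by
      have := hint.1
      exact this.mono_set (hA01.trans Set.Ioo_subset_Ioc_self)
    have hM0 : 0 ≤ M := by
      have h3 := hlogpos β hβ0 (by linarith)
      have : 0 ≤ Real.log (Real.log (W / β) / Real.log 2) :=
        Real.log_nonneg ((one_le_div hlog2).2 h3)
      linarith
    have h1 : ∫ ρ in A, M ≤ ∫ ρ in A, deriv h ρ :=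
      setIntegral_mono_on_ae (integrableOn_const hfin) hi hA hder
    have h2 : (1/4 : ℝ) ≤ volume.real A := by
      rw [measureReal_def]
      exact (ENNReal.ofReal_le_iff_le_toReal hfin).1 hvol
    rw [setIntegral_const, smul_eq_mul] at h1
    nlinarith
  have hAle : ∫ ρ in A, deriv h ρ ≤ ∫ ρ in (0:ℝ)..1, deriv h ρ := by
    rw [intervalIntegral.integral_of_le (by norm_num)]
    apply setIntegral_mono_set hint.1
    · exact Eventually.of_forall fun z => hmono.deriv_nonneg
    · exact (hA01.trans Set.Ioo_subset_Ioc_self).eventuallyLE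
  linarith [hmem.2]


lemma region_aux {ι : Type*} (E : Finset ι) (c x a b : ι → ℝ) (hc : ∀ e, 0 ≤ c e)
    (hx : ∀ e, 0 ≤ x e) (hba : ∀ e ∈ E, b e - a e ≤ x e) (N1 N2 : ℝ → ℝ) (hN1 : Monotone N1)
    (hN2 : Antitone N2) (hN1p : ∀ ρ, 0 ≤ N1 ρ) (hN2p : ∀ ρ, 0 ≤ N2 ρ)
    (Gd : Set ℝ) (hGd : MeasurableSet Gd) (hGd01 : Gd ⊆ Set.Ioo 0 1)
    (hvol : ENNReal.ofReal (1/2) ≤ volume Gd) (β N W M : ℝ) (hβ : 0 < β)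
    (hN : ∀ ρ ∈ Gd, N1 ρ + N2 ρ + 3 * β ≤ N)
    (hab : ∀ ρ ∈ Gd, ∀ e ∈ E, ρ < a e → ρ < b e)
    (hW : W = ∑ e ∈ E, c e * x e + N)
    (hM : 4 * Real.log (Real.log (W / β) / Real.log 2) < M) :
    ∃ ρ ∈ Gd, ∃ v, β ≤ v ∧
      ((N1 ρ + (∑ e ∈ E with b e ≤ ρ, c e * x e) ≤ v ∧
         v ≤ W - (N2 ρ + ∑ e ∈ E with ρ < a e, c e * x e)) ∨
       (N2 ρ + (∑ e ∈ E with ρ < a e, c e * x e) ≤ v ∧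
         v ≤ W - (N1 ρ + ∑ e ∈ E with b e ≤ ρ, c e * x e))) ∧
      ∑ e ∈ E with (a e ≤ ρ ∧ ρ < b e), c e ≤ M * (v * Real.log (W / v)) := by
  have hne : Gd.Nonempty := by
    by_contra h
    rw [Set.not_nonempty_iff_eq_empty] at h
    simp [h] at hvol
  have hcx : ∀ e, 0 ≤ c e * x e := fun e => mul_nonneg (hc e) (hx e)
  have hW2 : 2 * β < W := by
    obtain ⟨ρ, hρ⟩ := hne
    have := hN ρ hρ
    have h2 := Finset.sum_nonneg (s := E) (fun e _ => hcx e)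
    have := hN1p ρ
    have := hN2p ρ
    linarith
  set φ : ι → ℝ → ℝ := fun e ρ => if b e ≤ ρ then x e else max (ρ - a e) 0 with hφ
  set ψ : ι → ℝ → ℝ := fun e ρ => if ρ < a e then x e else max (b e - ρ) 0 with hψ
  set V : ℝ → ℝ := fun ρ => N1 ρ + β + ∑ e ∈ E, c e * φ e ρ with hV
  set U : ℝ → ℝ := fun ρ => N2 ρ + β + ∑ e ∈ E, c e * ψ e ρ with hU
  have hφ0 : ∀ e ρ, 0 ≤ φ e ρ := by
    intro e ρ; simp only [hφ]; split_ifs; exacts [hx e, le_max_right _ _]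
  have hψ0 : ∀ e ρ, 0 ≤ ψ e ρ := by
    intro e ρ; simp only [hψ]; split_ifs; exacts [hx e, le_max_right _ _]
  have hφm : ∀ e ∈ E, Monotone (φ e) := by
    intro e he p q hpq
    have := hba e he
    have := hx e
    simp only [hφ]
    split_ifs with h1 h2 h2
    · exact le_rfl
    · linarith
    · exact max_le (by linarith) (by linarith)
    · exact max_le_max (by linarith) le_rfl
  have hψm : ∀ e ∈ E, Antitone (ψ e) := by
    intro e he p q hpq
    have := hba e he
    have := hx e
    simp only [hψ]
    split_ifs with h1 h2 h2
    · exact le_rfl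
    · linarith
    · exact max_le (by linarith) (by linarith)
    · exact max_le_max (by linarith) le_rfl
  have hVm : Monotone V := by
    intro p q hpq
    have := hN1 hpq
    have : ∑ e ∈ E, c e * φ e p ≤ ∑ e ∈ E, c e * φ e q :=
      Finset.sum_le_sum fun e he => mul_le_mul_of_nonneg_left (hφm e he hpq) (hc e)
    simp only [hV]; linarith
  have hUm : Antitone U := by
    intro p q hpq
    have := hN2 hpq
    have : ∑ e ∈ E, c e * ψ e q ≤ ∑ e ∈ E, c e * ψ e p :=
      Finset.sum_le_sum fun e he => mul_le_mul_of_nonneg_left (hψm e he hpq) (hc e)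
    simp only [hU]; linarith
  have hVβ : ∀ ρ, β ≤ V ρ := by
    intro ρ
    have := hN1p ρ
    have : 0 ≤ ∑ e ∈ E, c e * φ e ρ := Finset.sum_nonneg fun e _ => mul_nonneg (hc e) (hφ0 e ρ)
    simp only [hV]; linarith
  have hUβ : ∀ ρ, β ≤ U ρ := by
    intro ρ
    have := hN2p ρ
    have : 0 ≤ ∑ e ∈ E, c e * ψ e ρ := Finset.sum_nonneg fun e _ => mul_nonneg (hc e) (hψ0 e ρ)
    simp only [hU]; linarith
  -- sum comparisons
  have key : ∀ ρ ∈ Gd, ∀ e ∈ E, φ e ρ + ψ e ρ ≤ x e := by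
    intro ρ hρ e he
    have := hba e he
    have := hx e
    have h3 := hab ρ hρ e he
    simp only [hφ, hψ]
    split_ifs with h1 h2 h2
    · linarith [h3 h2]
    · rw [max_eq_right (by linarith)]; linarith
    · rw [max_eq_right (by linarith)]; linarith
    · rw [max_eq_left (by linarith), max_eq_left (by linarith)]; linarith
  have hφle : ∀ ρ, ∀ e ∈ E, (if b e ≤ ρ then x e else 0) ≤ φ e ρ := by
    intro ρ e he
    simp only [hφ]
    split_ifs
    exacts [le_rfl, le_max_right _ _]
  have hψle : ∀ ρ, ∀ e ∈ E, (if ρ < a e then x e else 0) ≤ ψ e ρ := by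
    intro ρ e he
    simp only [hψ]
    split_ifs
    exacts [le_rfl, le_max_right _ _]
  have hs1 : ∀ ρ, ∑ e ∈ E with b e ≤ ρ, c e * x e ≤ ∑ e ∈ E, c e * φ e ρ := by
    intro ρ
    rw [Finset.sum_filter]
    refine Finset.sum_le_sum fun e he => ?_
    have := mul_le_mul_of_nonneg_left (hφle ρ e he) (hc e)
    simpa only [mul_ite, mul_zero] using this
  have hs2 : ∀ ρ, ∑ e ∈ E with ρ < a e, c e * x e ≤ ∑ e ∈ E, c e * ψ e ρ := by
    intro ρ
    rw [Finset.sum_filter]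
    refine Finset.sum_le_sum fun e he => ?_
    have := mul_le_mul_of_nonneg_left (hψle ρ e he) (hc e)
    simpa only [mul_ite, mul_zero] using this
  have hs3 : ∀ ρ ∈ Gd, ∑ e ∈ E, c e * φ e ρ + ∑ e ∈ E, c e * ψ e ρ ≤ ∑ e ∈ E, c e * x e := by
    intro ρ hρ
    rw [← Finset.sum_add_distrib]
    refine Finset.sum_le_sum fun e he => ?_
    rw [← mul_add]
    exact mul_le_mul_of_nonneg_left (key ρ hρ e he) (hc e)
  have hVU : ∀ ρ ∈ Gd, V ρ + U ρ < W := by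
    intro ρ hρ
    have := hs3 ρ hρ
    have := hN ρ hρ
    simp only [hV, hU]; linarith
  set cut : ℝ → ℝ := fun ρ => ∑ e ∈ E with (a e ≤ ρ ∧ ρ < b e), c e with hcutd
  set A : Set ℝ := Gd ∩ {ρ | V ρ < W / 2} with hA
  set B : Set ℝ := (Gd ∩ {ρ | U ρ < W / 2}) \ (a '' (E : Set ι)) with hB
  have hfin : (a '' (E : Set ι)).Finite := E.finite_toSet.image a
  have hcov : Gd ⊆ (A ∪ B) ∪ a '' (E : Set ι) := by
    intro ρ hρ
    by_cases h1 : ρ ∈ a '' (E : Set ι)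
    · exact Or.inr h1
    · left
      by_cases h2 : V ρ < W / 2
      · exact Or.inl ⟨hρ, h2⟩
      · refine Or.inr ⟨⟨hρ, ?_⟩, h1⟩
        have := hVU ρ hρ
        simp only [Set.mem_ofPred_eq]
        linarith
  have hAB : ENNReal.ofReal (1/4) ≤ volume A ∨ ENNReal.ofReal (1/4) ≤ volume B := by
    by_contra! hcon
    have h1 : volume Gd ≤ volume A + volume B := by
      calc volume Gd ≤ volume ((A ∪ B) ∪ a '' (E : Set ι)) := measure_mono hcov
        _ ≤ volume (A ∪ B) + volume (a '' (E : Set ι)) := measure_union_le _ _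
        _ = volume (A ∪ B) := by rw [hfin.measure_zero, add_zero]
        _ ≤ _ := measure_union_le _ _
    have h2 : volume A + volume B < ENNReal.ofReal (1/4) + ENNReal.ofReal (1/4) :=
      ENNReal.add_lt_add hcon.1 hcon.2
    rw [← ENNReal.ofReal_add (by norm_num) (by norm_num)] at h2
    norm_num at h2 hvol
    exact absurd (hvol.trans h1) (not_le.2 h2)
  have hAm : MeasurableSet A := hGd.inter (measurableSet_lt hVm.measurable measurable_const)
  have hBm : MeasurableSet B :=
    (hGd.inter (measurableSet_lt hUm.measurable measurable_const)).diff hfin.measurableSet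
  rcases hAB with hv | hv
  · obtain ⟨ρ, hρ, hle⟩ := rg_aux V hVm β W M hβ hVβ hW2 A hAm
      (fun z hz => hGd01 hz.1) hv (fun z hz => hz.2) cut (by
        intro ρ hρ
        have : ∀ᶠ σ in 𝓝[>] ρ, ∀ e ∈ E,
            (if (a e ≤ ρ ∧ ρ < b e) then c e else 0) * (σ - ρ) ≤ c e * φ e σ - c e * φ e ρ := by
          rw [eventually_all_finset]
          intro e he
          split_ifs with h
          · have h1 : ∀ᶠ σ in 𝓝[>] ρ, σ < b e := nhdsWithin_le_nhds (eventually_lt_nhds h.2)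
            filter_upwards [h1, self_mem_nhdsWithin] with σ h2 h3
            have h3 : ρ < σ := h3
            simp only [hφ]
            rw [if_neg (by linarith), if_neg (by linarith), max_eq_left (by linarith [h.1]),
              max_eq_left (by linarith [h.1])]
            apply le_of_eq; ring
          · filter_upwards [self_mem_nhdsWithin] with σ h3
            have h3 : ρ < σ := h3
            have := mul_le_mul_of_nonneg_left (hφm e he h3.le) (hc e)
            linarith
        filter_upwards [this, self_mem_nhdsWithin] with σ h1 h3
        have h3 : ρ < σ := h3
        have h4 := Finset.sum_le_sum h1
        rw [← Finset.sum_mul, ← Finset.sum_filter, Finset.sum_sub_distrib] at h4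
        have := hN1 h3.le
        simp only [hcutd, hV]
        linarith) hM
    refine ⟨ρ, hρ.1, V ρ, hVβ ρ, Or.inl ⟨?_, ?_⟩, hle⟩
    · have := hs1 ρ
      simp only [hV]; linarith
    · have := hVU ρ hρ.1
      have := hs2 ρ
      simp only [hU] at *; linarith
  · have hmp := (volume : Measure ℝ).measurePreserving_sub_left 1
    obtain ⟨τ, hτ, hle⟩ := rg_aux (fun τ => U (1 - τ)) (fun p q hpq => hUm (by linarith))
      β W M hβ (fun τ => hUβ _) hW2 ((fun τ => 1 - τ) ⁻¹' B) (hmp.measurable hBm)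
      (fun z hz => by
        have h := hGd01 hz.1.1
        exact ⟨by linarith [h.2], by linarith [h.1]⟩)
      (by rw [hmp.measure_preimage hBm.nullMeasurableSet]; exact hv)
      (fun z hz => hz.1.2) (fun τ => cut (1 - τ)) (by
        intro ρ hρ
        have : ∀ᶠ σ in 𝓝[>] ρ, ∀ e ∈ E,
            (if (a e ≤ 1 - ρ ∧ 1 - ρ < b e) then c e else 0) * (σ - ρ) ≤
              c e * ψ e (1 - σ) - c e * ψ e (1 - ρ) := by
          rw [eventually_all_finset]
          intro e he
          split_ifs with h
          · have hne : a e ≠ 1 - ρ := fun h' => hρ.2 ⟨e, he, h'⟩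
            have hlt : a e < 1 - ρ := lt_of_le_of_ne h.1 hne
            have h1 : ∀ᶠ σ in 𝓝[>] ρ, σ < 1 - a e :=
              nhdsWithin_le_nhds (eventually_lt_nhds (by linarith))
            filter_upwards [h1, self_mem_nhdsWithin] with σ h2 h3
            have h3 : ρ < σ := h3
            simp only [hψ]
            rw [if_neg (by linarith), if_neg (by linarith), max_eq_left (by linarith [h.2]),
              max_eq_left (by linarith [h.2])]
            apply le_of_eq; ring
          · filter_upwards [self_mem_nhdsWithin] with σ h3
            have h3 : ρ < σ := h3
            have := mul_le_mul_of_nonneg_left (hψm e he (show 1 - σ ≤ 1 - ρ by linarith)) (hc e)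
            linarith
        filter_upwards [this, self_mem_nhdsWithin] with σ h1 h3
        have h3 : ρ < σ := h3
        have h4 := Finset.sum_le_sum h1
        rw [← Finset.sum_mul, ← Finset.sum_filter, Finset.sum_sub_distrib] at h4
        have := hN2 (show 1 - σ ≤ 1 - ρ by linarith)
        simp only [hcutd, hU]
        linarith) hM
    refine ⟨1 - τ, hτ.1.1, U (1 - τ), hUβ _, Or.inr ⟨?_, ?_⟩, hle⟩
    · have := hs2 (1 - τ)
      simp only [hU]; linarith
    · have := hVU (1 - τ) hτ.1.1
      have := hs1 (1 - τ)
      simp only [hV] at *; linarith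

lemma pot_aux (β W W1 W2 v : ℝ) (hβ : 0 < β) (h1 : 0 ≤ W1) (h2 : 0 ≤ W2) (hv : β ≤ v)
    (hv1 : W1 ≤ v) (hv2 : v ≤ W - W2) :
    v * Real.log (W / v) + W1 * Real.log (max W1 β / β) + W2 * Real.log (max W2 β / β)
      ≤ W * Real.log (max W β / β) := by
  have hWv : v ≤ W := by linarith
  have hv0 : 0 < v := by linarith
  rw [max_eq_left (by linarith : β ≤ W)]
  have e1 : Real.log (max W1 β / β) ≤ Real.log (v / β) := by
    apply Real.log_le_log (div_pos (lt_max_of_lt_right hβ) hβ)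
    gcongr
    exact max_le hv1 hv
  have e2 : Real.log (max W2 β / β) ≤ Real.log (W / β) := by
    apply Real.log_le_log (div_pos (lt_max_of_lt_right hβ) hβ)
    gcongr
    exact max_le (by linarith) (by linarith)
  have e3 : Real.log (W / v) = Real.log (W / β) - Real.log (v / β) := by
    rw [Real.log_div (by linarith) (by linarith), Real.log_div (by linarith) (by linarith),
      Real.log_div (by linarith) (by linarith)]
    ring
  have hA : 0 ≤ Real.log (W / β) := Real.log_nonneg ((one_le_div hβ).2 (by linarith))
  have hB : 0 ≤ Real.log (v / β) := Real.log_nonneg ((one_le_div hβ).2 (by linarith))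
  rw [e3]
  have := mul_le_mul_of_nonneg_left e1 h1
  have := mul_le_mul_of_nonneg_left e2 h2
  have := mul_le_mul_of_nonneg_right (show v + W2 ≤ W by linarith) hA
  have := mul_le_mul_of_nonneg_right hv1 hB
  nlinarith

lemma good_aux {V : Type*} [Fintype V] (l u y : V → ℝ) (hlu : ∀ v, u v - l v ≤ y v)
    (hy0 : ∀ v, 0 ≤ y v) (hy : ∑ v, y v ≤ 1) :
    ∃ Gd : Set ℝ, MeasurableSet Gd ∧ Gd ⊆ Set.Ioo 0 1 ∧ ENNReal.ofReal (1/2) ≤ volume Gd ∧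
      ∀ ρ ∈ Gd, ∀ z w, l z ≤ ρ → ρ < u z → l w ≤ ρ → ρ < u w → z = w := by
  classical
  set f : ℝ → ENNReal := fun ρ => ∑ v, (Set.Ico (l v) (u v)).indicator (fun _ => (1:ENNReal)) ρ with hf
  have hfm : Measurable f := by
    apply Finset.measurable_sum
    intro v _
    exact measurable_const.indicator measurableSet_Ico
  have hBm : MeasurableSet {ρ | 2 ≤ f ρ} := measurableSet_le measurable_const hfm
  have hint : ∫⁻ ρ, f ρ ≤ 1 := by
    simp only [hf]
    rw [lintegral_finsetSum _ (fun v _ => measurable_const.indicator measurableSet_Ico)]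
    simp only [lintegral_indicator measurableSet_Ico, lintegral_const, one_mul,
      Measure.restrict_apply_univ, Real.volume_Ico]
    calc ∑ v, ENNReal.ofReal (u v - l v) ≤ ∑ v, ENNReal.ofReal (y v) :=
          Finset.sum_le_sum fun v _ => ENNReal.ofReal_le_ofReal (hlu v)
      _ = ENNReal.ofReal (∑ v, y v) := (ENNReal.ofReal_sum_of_nonneg fun v _ => hy0 v).symm
      _ ≤ 1 := by simpa using ENNReal.ofReal_le_ofReal hy
  have hmk : 2 * volume {ρ | 2 ≤ f ρ} ≤ 1 := (mul_meas_ge_le_lintegral hfm 2).trans hint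
  have hhalf : volume {ρ | 2 ≤ f ρ} ≤ ENNReal.ofReal (1/2) := by
    have h2 : (2 : ENNReal)⁻¹ = ENNReal.ofReal (1/2) := by
      rw [one_div, ENNReal.ofReal_inv_of_pos (by norm_num)]; norm_num
    rw [← h2, ← one_div, ENNReal.le_div_iff_mul_le (by simp) (by simp), mul_comm]
    exact hmk
  refine ⟨Set.Ioo 0 1 \ {ρ | 2 ≤ f ρ}, measurableSet_Ioo.diff hBm, Set.sdiff_subset, ?_, ?_⟩
  · have h1 : volume (Set.Ioo (0:ℝ) 1) ≤
        volume (Set.Ioo (0:ℝ) 1 \ {ρ | 2 ≤ f ρ}) + volume {ρ | 2 ≤ f ρ} := by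
      refine (measure_mono ?_).trans (measure_union_le _ _)
      intro z hz
      by_cases h : z ∈ {ρ | 2 ≤ f ρ}
      · exact Or.inr h
      · exact Or.inl ⟨hz, h⟩
    rw [Real.volume_Ioo] at h1
    have h2 := h1.trans (add_le_add_right hhalf _)
    have h3 : ENNReal.ofReal (1 - 0) = ENNReal.ofReal (1/2) + ENNReal.ofReal (1/2) := by
      rw [← ENNReal.ofReal_add (by norm_num) (by norm_num)]; norm_num
    rw [h3] at h2
    exact (ENNReal.add_le_add_iff_right ENNReal.ofReal_ne_top).1 h2
  · rintro ρ ⟨-, hρ⟩ z w h1 h2 h3 h4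
    by_contra hzw
    apply hρ
    show 2 ≤ f ρ
    have : ∑ v ∈ ({z, w} : Finset V), (Set.Ico (l v) (u v)).indicator (fun _ => (1:ENNReal)) ρ ≤ f ρ :=
      Finset.sum_le_sum_of_subset (Finset.subset_univ _)
    rw [Finset.sum_pair hzw, Set.indicator_of_mem (show ρ ∈ Set.Ico (l z) (u z) from ⟨h1, h2⟩),
      Set.indicator_of_mem (show ρ ∈ Set.Ico (l w) (u w) from ⟨h3, h4⟩),
      one_add_one_eq_two] at this
    exact this

lemma dist_aux {V : Type*} [DecidableEq V] (G : SimpleGraph V) (x : Sym2 V → ℝ) (y : V → ℝ)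
    (s t : V) (hx : ∀ e, 0 ≤ x e) (hy : ∀ v, 0 ≤ y v) (hys : y s = 0)
    (hp : ∀ p : G.Walk s t, p.IsPath → 1 ≤ (p.edges.map x).sum + (p.support.map y).sum) :
    ∃ d : V → ℝ, (∀ v, 0 ≤ d v) ∧ d s = 0 ∧ 1 ≤ d t ∧
      ∀ u v, G.Adj u v → d v ≤ d u + x s(u, v) + y v := by
  set wt : ∀ v, G.Walk s v → ℝ := fun v p => (p.edges.map x).sum + (p.support.map y).sum with hwt
  set S : V → Set ℝ := fun v => {1} ∪ Set.range (wt v) with hS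
  have hne : ∀ v, (S v).Nonempty := fun v => ⟨1, Or.inl rfl⟩
  have hnn : ∀ v, ∀ w ∈ S v, 0 ≤ w := by
    rintro v w (rfl | ⟨p, rfl⟩)
    · norm_num
    · refine add_nonneg (List.sum_nonneg ?_) (List.sum_nonneg ?_)
      · simp only [List.mem_map]; rintro _ ⟨e, -, rfl⟩; exact hx e
      · simp only [List.mem_map]; rintro _ ⟨e, -, rfl⟩; exact hy e
  have hbd : ∀ v, BddBelow (S v) := fun v => ⟨0, hnn v⟩
  refine ⟨fun v => sInf (S v), fun v => le_csInf (hne v) (hnn v), ?_, ?_, ?_⟩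
  · refine le_antisymm ?_ (le_csInf (hne s) (hnn s))
    refine csInf_le (hbd s) (Or.inr ⟨SimpleGraph.Walk.nil, ?_⟩)
    simp [hwt, hys]
  · refine le_csInf (hne t) ?_
    rintro w (rfl | ⟨p, rfl⟩)
    · exact le_rfl
    · refine (hp p.bypass p.bypass_isPath).trans (add_le_add ?_ ?_)
      · refine List.Sublist.sum_le_sum (p.edges_bypass_sublist_edges.map x) ?_
        simp only [List.mem_map]; rintro _ ⟨e, -, rfl⟩; exact hx e
      · refine List.Sublist.sum_le_sum (p.support_bypass_sublist_support.map y) ?_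
        simp only [List.mem_map]; rintro _ ⟨e, -, rfl⟩; exact hy e
  · intro u v huv
    have : sInf (S v) - x s(u, v) - y v ≤ sInf (S u) := by
      refine le_csInf (hne u) ?_
      rintro w (rfl | ⟨p, rfl⟩)
      · have : sInf (S v) ≤ 1 := csInf_le (hbd v) (Or.inl rfl)
        have := hx s(u, v)
        have := hy v
        linarith
      · have : sInf (S v) ≤ wt v (p.concat huv) := csInf_le (hbd v) (Or.inr ⟨_, rfl⟩)
        have h2 : wt v (p.concat huv) = wt u p + x s(u, v) + y v := by
          simp only [hwt, SimpleGraph.Walk.edges_concat, SimpleGraph.Walk.support_concat,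
            List.concat_eq_append, List.map_append, List.sum_append, List.map_cons, List.map_nil,
            List.sum_cons, List.sum_nil]
          ring
        linarith
    linarith

lemma cross_aux {V : Type*} {G : SimpleGraph V} (P1 P2 : Set (Sym2 V)) (A1 A2 : Set V)
    (h2 : ∀ e ∈ P2, ∀ v ∈ e, v ∈ A2) (h1 : ∀ e ∈ P1, ∀ v ∈ e, v ∈ A1) {a b : V}
    (p : G.Walk a b) (ha : a ∈ A2) (hb : b ∈ A1) (h : ∀ e ∈ p.edges, e ∈ P1 ∨ e ∈ P2) :
    ∃ z ∈ p.support, z ∈ A1 ∧ z ∈ A2 := by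
  induction p with
  | nil => exact ⟨_, by simp, hb, ha⟩
  | @cons a a' b hadj p ih =>
    by_cases haA : a ∈ A1
    · exact ⟨a, by simp, haA, ha⟩
    · rcases h s(a, a') (by simp) with h' | h'
      · exact absurd (h1 _ h' a (by simp)) haA
      · obtain ⟨z, hz, hz'⟩ := ih (h2 _ h' a' (by simp)) hb (fun e he => h e (by simp [he]))
        exact ⟨z, by simp [hz], hz'⟩

lemma stay_aux {V : Type*} {G : SimpleGraph V} (P1 P2 : Set (Sym2 V)) (A1 A2 : Set V)
    (h2 : ∀ e ∈ P2, ∀ v ∈ e, v ∈ A2) (h1 : ∀ e ∈ P1, ∀ v ∈ e, v ∈ A1)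
    (hone : ∀ z w, z ∈ A1 → z ∈ A2 → w ∈ A1 → w ∈ A2 → z = w) {a b : V}
    (p : G.Walk a b) (hp : p.IsPath) (ha : a ∈ A1) (hb : b ∈ A1)
    (h : ∀ e ∈ p.edges, e ∈ P1 ∨ e ∈ P2) :
    ∀ e ∈ p.edges, e ∈ P1 := by
  induction p with
  | nil => simp
  | @cons a a' b hadj p ih =>
    rw [SimpleGraph.Walk.cons_isPath_iff] at hp
    rcases h s(a, a') (by simp) with h' | h'
    · intro e he
      rw [SimpleGraph.Walk.edges_cons, List.mem_cons] at he
      rcases he with rfl | he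
      · exact h'
      · exact ih hp.1 (h1 _ h' a' (by simp)) hb (fun e he => h e (by simp [he])) e he
    · obtain ⟨z, hz, hz1, hz2⟩ := cross_aux P1 P2 A1 A2 h2 h1 p (h2 _ h' a' (by simp)) hb
        (fun e he => h e (by simp [he]))
      have : z = a := hone _ _ hz1 hz2 ha (h2 _ h' a (by simp))
      subst this
      exact absurd hz hp.2

/-- two internally disjoint routes using only edges of `E` -/
def TwoRoutes {V : Type*} (G : SimpleGraph V) (E : Set (Sym2 V)) (a b : V) : Prop :=
  ∃ p q : G.Walk a b, p.IsPath ∧ q.IsPath ∧ p ≠ q ∧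
    (∀ w, w ∈ p.support → w ∈ q.support → w = a ∨ w = b) ∧
    (∀ e ∈ p.edges, e ∈ E) ∧ (∀ e ∈ q.edges, e ∈ E)

lemma combine_aux {V : Type*} {G : SimpleGraph V} (P1 P2 E : Set (Sym2 V)) (A1 A2 : Set V)
    (h2 : ∀ e ∈ P2, ∀ v ∈ e, v ∈ A2) (h1 : ∀ e ∈ P1, ∀ v ∈ e, v ∈ A1)
    (hone : ∀ z w, z ∈ A1 → z ∈ A2 → w ∈ A1 → w ∈ A2 → z = w)
    (hun : ∀ v, v ∈ A1 ∨ v ∈ A2)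
    (hE : ∀ e ∈ E, e ∈ P1 ∨ e ∈ P2) (a b : V)
    (hT1 : a ∈ A1 → b ∈ A1 → ¬ TwoRoutes G P1 a b)
    (hT2 : a ∈ A2 → b ∈ A2 → ¬ TwoRoutes G P2 a b) : ¬ TwoRoutes G E a b := by
  rintro ⟨p, q, hp, hq, hpq, hd, hpE, hqE⟩
  have hp' := fun e he => hE e (hpE e he)
  have hq' := fun e he => hE e (hqE e he)
  have hone' : ∀ z w, z ∈ A2 → z ∈ A1 → w ∈ A2 → w ∈ A1 → z = w :=
    fun z w a b c d => hone z w b a d c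
  by_cases c1 : a ∈ A1 ∧ b ∈ A1
  · exact hT1 c1.1 c1.2 ⟨p, q, hp, hq, hpq, hd,
      stay_aux P1 P2 A1 A2 h2 h1 hone p hp c1.1 c1.2 hp',
      stay_aux P1 P2 A1 A2 h2 h1 hone q hq c1.1 c1.2 hq'⟩
  by_cases c2 : a ∈ A2 ∧ b ∈ A2
  · exact hT2 c2.1 c2.2 ⟨p, q, hp, hq, hpq, hd,
      stay_aux P2 P1 A2 A1 h1 h2 hone' p hp c2.1 c2.2 (fun e he => (hp' e he).symm),
      stay_aux P2 P1 A2 A1 h1 h2 hone' q hq c2.1 c2.2 (fun e he => (hq' e he).symm)⟩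
  have key : ∃ z ∈ p.support, ∃ w ∈ q.support, (z ∈ A1 ∧ z ∈ A2) ∧ (w ∈ A1 ∧ w ∈ A2) := by
    rcases hun a with ha | ha
    · have hb : b ∈ A2 := (hun b).resolve_left fun hb => c1 ⟨ha, hb⟩
      obtain ⟨z, hz, hz'⟩ := cross_aux P2 P1 A2 A1 h1 h2 p ha hb (fun e he => (hp' e he).symm)
      obtain ⟨w, hw, hw'⟩ := cross_aux P2 P1 A2 A1 h1 h2 q ha hb (fun e he => (hq' e he).symm)
      exact ⟨z, hz, w, hw, hz'.symm, hw'.symm⟩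
    · have hb : b ∈ A1 := (hun b).resolve_right fun hb => c2 ⟨ha, hb⟩
      obtain ⟨z, hz, hz'⟩ := cross_aux P1 P2 A1 A2 h2 h1 p ha hb hp'
      obtain ⟨w, hw, hw'⟩ := cross_aux P1 P2 A1 A2 h2 h1 q ha hb hq'
      exact ⟨z, hz, w, hw, hz', hw'⟩
  obtain ⟨z, hz, w, hw, hz', hw'⟩ := key
  have hzw := hone z w hz'.1 hz'.2 hw'.1 hw'.2
  subst hzw
  rcases hd z hz hw with rfl | rfl
  · rcases hun b with hb | hb
    · exact c1 ⟨hz'.1, hb⟩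
    · exact c2 ⟨hz'.2, hb⟩
  · rcases hun a with hb | hb
    · exact c1 ⟨hb, hz'.1⟩
    · exact c2 ⟨hb, hz'.2⟩

/-- edge lower threshold -/
noncomputable def eLo {V : Type*} (d : V → ℝ) (e : Sym2 V) : ℝ :=
  Sym2.lift ⟨fun u v => min (d u) (d v), fun _ _ => min_comm _ _⟩ e

/-- edge upper threshold -/
noncomputable def eHi {V : Type*} (d : V → ℝ) (e : Sym2 V) : ℝ :=
  Sym2.lift ⟨fun u v => max (d u) (d v), fun _ _ => max_comm _ _⟩ e

lemma eLo_mk {V : Type*} (d : V → ℝ) (u v : V) : eLo d s(u, v) = min (d u) (d v) := rfl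
lemma eHi_mk {V : Type*} (d : V → ℝ) (u v : V) : eHi d s(u, v) = max (d u) (d v) := rfl

lemma eLo_mem {V : Type*} (d : V → ℝ) (e : Sym2 V) (v : V) (hv : v ∈ e) : eLo d e ≤ d v := by
  induction e with
  | _ a b =>
    rw [eLo_mk]
    rcases Sym2.mem_iff.1 hv with rfl | rfl
    · exact min_le_left _ _
    · exact min_le_right _ _

lemma eHi_mem {V : Type*} (d : V → ℝ) (e : Sym2 V) (v : V) (hv : v ∈ e) : d v ≤ eHi d e := by
  induction e with
  | _ a b =>
    rw [eHi_mk]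
    rcases Sym2.mem_iff.1 hv with rfl | rfl
    · exact le_max_left _ _
    · exact le_max_right _ _

set_option maxHeartbeats 2000000 in
lemma main_ind {V ι : Type*} [Fintype V] [DecidableEq V] [DecidableEq ι] (G : SimpleGraph V)
    (c x : Sym2 V → ℝ) (s t : ι → V) (y d : ι → V → ℝ)
    (hc : ∀ e, 0 ≤ c e) (hx : ∀ e, 0 ≤ x e) (hy : ∀ i v, 0 ≤ y i v)
    (hys : ∀ i, ∑ v, y i v ≤ 1) (hyt : ∀ i, y i (t i) = 0)
    (hd0 : ∀ i v, 0 ≤ d i v) (hds : ∀ i, d i (s i) = 0) (hdt : ∀ i, 1 ≤ d i (t i))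
    (hde : ∀ i u v, G.Adj u v → d i v ≤ d i u + x s(u, v) + y i v)
    (β W0 M : ℝ) (hβ : 0 < β) (hM0 : 0 ≤ M)
    (hM : 4 * Real.log (Real.log (W0 / β) / Real.log 2) < M) (n : ℕ) :
    ∀ (E : Finset (Sym2 V)) (R : Finset ι), R.card = n → (∀ e ∈ E, e ∈ G.edgeSet) →
      ∑ e ∈ E, c e * x e + 3 * β * R.card ≤ W0 →
      ∃ F : Finset (Sym2 V), F ⊆ E ∧
        ∑ e ∈ F, c e ≤ M * ((∑ e ∈ E, c e * x e + 3 * β * R.card) *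
          Real.log (max (∑ e ∈ E, c e * x e + 3 * β * R.card) β / β)) ∧
        ∀ i ∈ R, ¬ TwoRoutes G (↑(E \ F)) (s i) (t i) := by
  induction n using Nat.strong_induction_on with
  | _ n ih =>
  intro E R hRn hEG hWle
  have hcx : ∀ e, 0 ≤ c e * x e := fun e => mul_nonneg (hc e) (hx e)
  have hsum0 : ∀ E : Finset (Sym2 V), 0 ≤ ∑ e ∈ E, c e * x e :=
    fun E => Finset.sum_nonneg fun e _ => hcx e
  have hlog2 : 0 < Real.log 2 := Real.log_pos (by norm_num)
  rcases R.eq_empty_or_nonempty with rfl | ⟨i, hi⟩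
  · refine ⟨∅, Finset.empty_subset _, ?_, by simp⟩
    simp only [Finset.sum_empty]
    refine mul_nonneg hM0 (mul_nonneg ?_ (Real.log_nonneg ?_))
    · have := hsum0 E; simpa using this
    · rw [one_le_div hβ]; exact le_max_right _ _
  have hR1 : (1 : ℝ) ≤ R.card := by exact_mod_cast Finset.card_pos.2 ⟨i, hi⟩
  set W := ∑ e ∈ E, c e * x e + 3 * β * R.card with hW
  have hW3 : 3 * β ≤ W := by
    have := hsum0 E
    nlinarith
  have hMW : 4 * Real.log (Real.log (W / β) / Real.log 2) < M := by
    refine lt_of_le_of_lt ?_ hM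
    have h1 : Real.log 2 ≤ Real.log (W / β) := by
      apply Real.log_le_log (by norm_num)
      rw [le_div_iff₀ hβ]; linarith
    have h2 : Real.log (W / β) ≤ Real.log (W0 / β) := by
      apply Real.log_le_log (div_pos (by linarith) hβ)
      gcongr
    have : Real.log (Real.log (W / β) / Real.log 2) ≤ Real.log (Real.log (W0 / β) / Real.log 2) := by
      apply Real.log_le_log (div_pos (by linarith) hlog2)
      gcongr
    linarith
  have hst : ∀ j, s j ≠ t j := by
    intro j h
    have h1 := hds j
    have h2 := hdt j
    rw [h] at h1
    linarith
  set D := d i with hD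
  set m : V → ℝ := fun v => max (D v - y i v) 0 with hm
  have hmD : ∀ v, m v ≤ D v := fun v => max_le (by linarith [hy i v]) (hd0 i v)
  obtain ⟨Gd, hGdm, hGd01, hGdv, hGdu⟩ := good_aux m D (y i)
    (fun v => by have := le_max_left (D v - y i v) 0; simp only [hm]; linarith) (hy i) (hys i)
  set R1 : ℝ → Finset ι := fun ρ => {j ∈ R | m (s j) ≤ ρ ∧ m (t j) ≤ ρ} with hR1d
  set R2 : ℝ → Finset ι := fun ρ => {j ∈ R | ρ < D (s j) ∧ ρ < D (t j)} with hR2d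
  have hcard : ∀ ρ ∈ Gd, (R1 ρ).card + (R2 ρ).card + 1 ≤ R.card := by
    intro ρ hρ
    have hdis : Disjoint (R1 ρ) (R2 ρ) := by
      rw [Finset.disjoint_left]
      intro j h1 h2
      simp only [hR1d, hR2d, Finset.mem_filter] at h1 h2
      exact hst j (hGdu ρ hρ _ _ h1.2.1 h2.2.1 h1.2.2 h2.2.2)
    rw [← Finset.card_union_of_disjoint hdis]
    have hsub : R1 ρ ∪ R2 ρ ⊆ R.erase i := by
      intro j hj
      rw [Finset.mem_union] at hj
      rw [Finset.mem_erase]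
      have h01 := hGd01 hρ
      rcases hj with hj | hj
      · simp only [hR1d, Finset.mem_filter] at hj
        refine ⟨?_, hj.1⟩
        rintro rfl
        have h2 := hj.2.2
        have h3 := hdt j
        have h4 := le_max_left (D (t j) - y j (t j)) 0
        simp only [hm] at h2
        rw [hyt j] at h2 h4
        linarith [h01.2]
      · simp only [hR2d, Finset.mem_filter] at hj
        refine ⟨?_, hj.1⟩
        rintro rfl
        have h2 := hj.2.1
        have h3 := hds j
        linarith [h01.1]
    have := Finset.card_le_card hsub
    rw [Finset.card_erase_of_mem hi] at this
    have := Finset.card_pos.2 ⟨i, hi⟩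
    omega
  have hab : ∀ ρ ∈ Gd, ∀ e ∈ E, ρ < eLo D e → ρ < eHi m e := by
    intro ρ hρ e he h1
    by_contra! h2
    have heG := hEG e he
    induction e with
    | _ u v =>
      have hne : u ≠ v := G.ne_of_adj heG
      rw [eLo_mk, lt_min_iff] at h1
      rw [eHi_mk, max_le_iff] at h2
      exact hne (hGdu ρ hρ u v h2.1 h1.1 h2.2 h1.2)
  have hba : ∀ e ∈ E, eHi m e - eLo D e ≤ x e := by
    intro e he
    have heG := hEG e he
    induction e with
    | _ u v =>
      have huv : G.Adj u v := heG
      have h1 := hde i u v huv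
      have h2 := hde i v u huv.symm
      rw [Sym2.eq_swap] at h2
      have h3 := hx s(u, v)
      have h4 := hmD u
      have h5 := hmD v
      have h6 := hd0 i u
      have h7 := hd0 i v
      have h8 : m v ≤ D u + x s(u, v) := max_le (by simp only [hD]; linarith) (by simp only [hD]; linarith)
      have h9 : m u ≤ D v + x s(u, v) := max_le (by simp only [hD]; linarith) (by simp only [hD]; linarith)
      rw [eLo_mk, eHi_mk, sub_le_iff_le_add]
      rcases le_total (D u) (D v) with h | h
      · rw [min_eq_left h]; exact max_le (by linarith) (by linarith)
      · rw [min_eq_right h]; exact max_le (by linarith) (by linarith)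
  obtain ⟨ρ, hρ, v, hβv, hvW, hcut⟩ := region_aux E c x (eLo D) (eHi m) hc hx hba
    (fun ρ => 3 * β * (R1 ρ).card) (fun ρ => 3 * β * (R2 ρ).card)
    (by
      intro p q hpq
      have : (R1 p).card ≤ (R1 q).card := by
        apply Finset.card_le_card
        intro j hj
        simp only [hR1d, Finset.mem_filter] at hj ⊢
        exact ⟨hj.1, hj.2.1.trans hpq, hj.2.2.trans hpq⟩
      have : ((R1 p).card : ℝ) ≤ (R1 q).card := by exact_mod_cast this
      exact mul_le_mul_of_nonneg_left this (by linarith))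
    (by
      intro p q hpq
      have : (R2 q).card ≤ (R2 p).card := by
        apply Finset.card_le_card
        intro j hj
        simp only [hR2d, Finset.mem_filter] at hj ⊢
        exact ⟨hj.1, lt_of_le_of_lt hpq hj.2.1, lt_of_le_of_lt hpq hj.2.2⟩
      have : ((R2 q).card : ℝ) ≤ (R2 p).card := by exact_mod_cast this
      exact mul_le_mul_of_nonneg_left this (by linarith))
    (fun ρ => by positivity) (fun ρ => by positivity) Gd hGdm hGd01 hGdv β
    (3 * β * R.card) W M hβ
    (by
      intro ρ hρ
      have := hcard ρ hρ
      have : ((R1 ρ).card : ℝ) + (R2 ρ).card + 1 ≤ R.card := by exact_mod_cast this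
      nlinarith)
    hab hW hMW
  have hone := hGdu ρ hρ
  have hcd := hcard ρ hρ
  set E1 := {e ∈ E | eHi m e ≤ ρ} with hE1
  set E2 := {e ∈ E | ρ < eLo D e} with hE2
  set X := {e ∈ E | eLo D e ≤ ρ ∧ ρ < eHi m e} with hX
  have hE1s : E1 ⊆ E := Finset.filter_subset _ _
  have hE2s : E2 ⊆ E := Finset.filter_subset _ _
  have hXs : X ⊆ E := Finset.filter_subset _ _
  set W1 := ∑ e ∈ E1, c e * x e + 3 * β * (R1 ρ).card with hW1
  set W2 := ∑ e ∈ E2, c e * x e + 3 * β * (R2 ρ).card with hW2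
  have hW1p : 0 ≤ W1 := add_nonneg (hsum0 _) (by positivity)
  have hW2p : 0 ≤ W2 := add_nonneg (hsum0 _) (by positivity)
  have hvW' : (W1 ≤ v ∧ v ≤ W - W2) ∨ (W2 ≤ v ∧ v ≤ W - W1) := by
    rcases hvW with h | h
    · left; constructor <;> linarith [h.1, h.2]
    · right; constructor <;> linarith [h.1, h.2]
  have hWW : W1 ≤ W ∧ W2 ≤ W := by
    rcases hvW' with h | h
    · constructor <;> linarith [h.1, h.2]
    · constructor <;> linarith [h.1, h.2]
  obtain ⟨F1, hF1, hF1c, hF1T⟩ := ih (R1 ρ).card (by omega) E1 (R1 ρ) rfl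
    (fun e he => hEG e (hE1s he)) (hWW.1.trans hWle)
  obtain ⟨F2, hF2, hF2c, hF2T⟩ := ih (R2 ρ).card (by omega) E2 (R2 ρ) rfl
    (fun e he => hEG e (hE2s he)) (hWW.2.trans hWle)
  rw [← hW1] at hF1c
  rw [← hW2] at hF2c
  refine ⟨X ∪ F1 ∪ F2, ?_, ?_, ?_⟩
  · exact Finset.union_subset (Finset.union_subset hXs (hF1.trans hE1s)) (hF2.trans hE2s)
  · have hu : ∑ e ∈ X ∪ F1 ∪ F2, c e ≤ ∑ e ∈ X, c e + ∑ e ∈ F1, c e + ∑ e ∈ F2, c e := by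
      have hgen : ∀ P Q : Finset (Sym2 V), ∑ e ∈ P ∪ Q, c e ≤ ∑ e ∈ P, c e + ∑ e ∈ Q, c e := by
        intro P Q
        rw [← Finset.sum_union_inter]
        exact le_add_of_nonneg_right (Finset.sum_nonneg fun e _ => hc e)
      have h1 := hgen (X ∪ F1) F2
      have h2 := hgen X F1
      linarith
    have hpot : v * Real.log (W / v) + W1 * Real.log (max W1 β / β) + W2 * Real.log (max W2 β / β)
      ≤ W * Real.log (max W β / β) := by
      rcases hvW' with h | h
      · exact pot_aux β W W1 W2 v hβ hW1p hW2p hβv h.1 h.2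
      · have := pot_aux β W W2 W1 v hβ hW2p hW1p hβv h.1 h.2
        linarith
    have := mul_le_mul_of_nonneg_left hpot hM0
    have hcut' : ∑ e ∈ X, c e ≤ M * (v * Real.log (W / v)) := hcut
    linarith
  · intro j hj
    refine combine_aux (↑(E1 \ F1)) (↑(E2 \ F2)) _ {z | m z ≤ ρ} {z | ρ < D z} ?_ ?_ ?_ ?_ ?_
      (s j) (t j) ?_ ?_
    · intro e he z hz
      have he : e ∈ E2 \ F2 := by exact_mod_cast he
      have := (Finset.mem_filter.1 (Finset.mem_sdiff.1 he).1).2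
      exact this.trans_le (eLo_mem D e z hz)
    · intro e he z hz
      have he : e ∈ E1 \ F1 := by exact_mod_cast he
      have := (Finset.mem_filter.1 (Finset.mem_sdiff.1 he).1).2
      exact (eHi_mem m e z hz).trans this
    · intro z w h1 h2 h3 h4
      exact hone z w h1 h2 h3 h4
    · intro z
      rcases le_or_gt (D z) ρ with h | h
      · exact Or.inl ((hmD z).trans h)
      · exact Or.inr h
    · intro e he
      have he : e ∈ E \ (X ∪ F1 ∪ F2) := by exact_mod_cast he
      simp only [Finset.mem_sdiff, Finset.mem_union, not_or] at he
      obtain ⟨heE, ⟨heX, he1⟩, he2⟩ := he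
      by_cases h1 : eHi m e ≤ ρ
      · left
        rw [Finset.mem_coe, Finset.mem_sdiff]
        exact ⟨Finset.mem_filter.2 ⟨heE, h1⟩, he1⟩
      · right
        rw [Finset.mem_coe, Finset.mem_sdiff]
        refine ⟨Finset.mem_filter.2 ⟨heE, ?_⟩, he2⟩
        by_contra! h2
        exact heX (Finset.mem_filter.2 ⟨heE, h2, not_le.1 h1⟩)
    · intro h1 h2
      exact hF1T j (Finset.mem_filter.2 ⟨hj, h1, h2⟩)
    · intro h1 h2
      exact hF2T j (Finset.mem_filter.2 ⟨hj, h1, h2⟩)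

/-- Rounding guarantee for edge-deletion 2-route node-multicut:
there is an absolute constant `C > 0` such that for every instance and every feasible
fractional solution `(x, {yⁱ})` of the LP (P2) with `k = 2`, there is an edge set `F`
of cost at most `C · ln(r+1) · ln ln(e(r+1)) · Σ_e c_e x_e` whose deletion leaves no
two distinct internally vertex-disjoint `sᵢ`–`tᵢ` paths, for every `i`. -/
theorem stmt_15 : ∃ C : ℝ, 0 < C ∧
    ∀ (V : Type) [Fintype V] [DecidableEq V] (G : SimpleGraph V) [DecidableRel G.Adj]
      (c : Sym2 V → ℝ) (r : ℕ) (s t : Fin r → V)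
      (x : Sym2 V → ℝ) (y : Fin r → V → ℝ),
      (∀ e, 0 ≤ c e) → (∀ e, 0 ≤ x e) → (∀ i v, 0 ≤ y i v) →
      (∀ i (p : G.Walk (s i) (t i)), p.IsPath →
        1 ≤ (p.edges.map x).sum + (p.support.map (y i)).sum) →
      (∀ i, ∑ v, y i v ≤ 1) →
      (∀ i, y i (s i) = 0 ∧ y i (t i) = 0) →
      ∃ F : Finset (Sym2 V), ↑F ⊆ G.edgeSet ∧
        (∑ e ∈ F, c e) ≤ C * Real.log (r + 1) *
            Real.log (Real.log (Real.exp 1 * (r + 1))) *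
            ∑ e ∈ G.edgeFinset, c e * x e ∧
        ∀ i, ¬ ∃ p q : (G.deleteEdges ↑F).Walk (s i) (t i),
          p.IsPath ∧ q.IsPath ∧ p ≠ q ∧
          (∀ w, w ∈ p.support → w ∈ q.support → w = s i ∨ w = t i) := by
  refine ⟨80, by norm_num, ?_⟩
  intro V _ _ G _ c r s t x y hc hx hy hp hys hst0
  have hcx : ∀ e, 0 ≤ c e * x e := fun e => mul_nonneg (hc e) (hx e)
  set O := ∑ e ∈ G.edgeFinset, c e * x e with hO
  have hO0 : 0 ≤ O := Finset.sum_nonneg fun e _ => hcx e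
  rcases Nat.eq_zero_or_pos r with rfl | hr
  · exact ⟨∅, by simp, by simp, fun i => i.elim0⟩
  have hr1 : (1 : ℝ) ≤ r := by exact_mod_cast hr
  have hl2 : Real.log 2 ≤ Real.log (r + 1) := Real.log_le_log (by norm_num) (by linarith)
  have hlog2 : 0.69 < Real.log 2 := by linarith [Real.log_two_gt_d9]
  set l := Real.log (r + 1) with hl
  have hee : Real.log (Real.exp 1 * (r + 1)) = 1 + l := by
    rw [Real.log_mul (Real.exp_ne_zero _) (by linarith), Real.log_exp]
  rw [hee]
  have hll : 0 ≤ Real.log (1 + l) := Real.log_nonneg (by linarith)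
  have hl0 : 0 ≤ l := by linarith
  rcases hO0.eq_or_lt with hz | hpos
  · -- zero fractional cost
    have hzero : ∀ e ∈ G.edgeFinset, c e * x e = 0 :=
      (Finset.sum_eq_zero_iff_of_nonneg fun e _ => hcx e).1 hz.symm
    refine ⟨{e ∈ G.edgeFinset | 0 < x e}, ?_, ?_, ?_⟩
    · intro e he
      have he : e ∈ ({e ∈ G.edgeFinset | 0 < x e} : Finset (Sym2 V)) := by exact_mod_cast he
      exact SimpleGraph.mem_edgeFinset.1 (Finset.mem_filter.1 he).1
    · rw [← hz, mul_zero]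
      apply le_of_eq
      refine Finset.sum_eq_zero fun e he => ?_
      rw [Finset.mem_filter] at he
      rcases mul_eq_zero.1 (hzero e he.1) with h | h
      · exact h
      · linarith [he.2]
    · set F : Finset (Sym2 V) := {e ∈ G.edgeFinset | 0 < x e} with hF
      rintro i ⟨p, q, hpp, hqp, hpq, hd⟩
      have hle : G.deleteEdges ↑F ≤ G := SimpleGraph.deleteEdges_le _
      have gen : ∀ p : (G.deleteEdges ↑F).Walk (s i) (t i), p.IsPath →
          1 ≤ ∑ v ∈ p.support.toFinset, y i v := by
        intro p hpp
        have h1 := hp i (p.mapLe hle) ((SimpleGraph.Walk.isPath_mapLe hle).2 hpp)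
        rw [SimpleGraph.Walk.edges_mapLe_eq_edges, SimpleGraph.Walk.support_mapLe_eq_support] at h1
        have h2 : (p.edges.map x).sum = 0 := by
          apply List.sum_eq_zero
          simp only [List.mem_map]
          rintro _ ⟨e, he, rfl⟩
          have h3 := p.edges_subset_edgeSet he
          rw [SimpleGraph.edgeSet_deleteEdges] at h3
          by_contra hne
          apply h3.2
          rw [Finset.mem_coe, hF, Finset.mem_filter, SimpleGraph.mem_edgeFinset]
          exact ⟨h3.1, lt_of_le_of_ne (hx e) (Ne.symm hne)⟩
        rw [h2, zero_add] at h1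
        rwa [List.sum_toFinset _ hpp.support_nodup]
      have h1 := gen p hpp
      have h2 := gen q hqp
      have h3 := Finset.sum_union_inter (s₁ := p.support.toFinset) (s₂ := q.support.toFinset)
        (f := y i)
      have h4 : ∑ v ∈ p.support.toFinset ∩ q.support.toFinset, y i v = 0 := by
        refine Finset.sum_eq_zero fun v hv => ?_
        simp only [Finset.mem_inter, List.mem_toFinset] at hv
        rcases hd v hv.1 hv.2 with h | h
        · rw [h]; exact (hst0 i).1
        · rw [h]; exact (hst0 i).2
      have h5 : ∑ v ∈ p.support.toFinset ∪ q.support.toFinset, y i v ≤ ∑ v, y i v :=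
        Finset.sum_le_sum_of_subset_of_nonneg (Finset.subset_univ _) fun v _ _ => hy i v
      have h6 := hys i
      linarith
  · choose d hd0 hds hdt hde using fun i =>
      dist_aux G x (y i) (s i) (t i) hx (hy i) (hst0 i).1 (hp i)
    set β := O / r with hβ
    have hβ0 : 0 < β := div_pos hpos (by linarith)
    have hβr : β * r = O := by rw [hβ]; field_simp
    have hW : O + 3 * β * (Finset.univ : Finset (Fin r)).card = 4 * O := by
      rw [Finset.card_univ, Fintype.card_fin]; linarith
    have hWβ : 4 * O / β = 4 * r := by
      rw [← hβr]; field_simp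
    have h4r : Real.log (4 * r) ≤ 2 * l := by
      have : 2 * l = Real.log ((r + 1)^2) := by rw [Real.log_pow]; norm_num [hl]
      rw [this]
      apply Real.log_le_log (by linarith)
      nlinarith [sq_nonneg ((r:ℝ) - 1)]
    have h4 : 2 * Real.log 2 ≤ Real.log (4 * r) := by
      have : 2 * Real.log 2 = Real.log (2^2) := by rw [Real.log_pow]; norm_num
      rw [this]
      apply Real.log_le_log (by norm_num)
      linarith
    set L := Real.log (Real.log (4 * r) / Real.log 2) with hL
    have hLpos : 0 < L := by
      apply Real.log_pos
      rw [lt_div_iff₀ (by linarith)]; linarith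
    have hLle : L ≤ 2 * Real.log (1 + l) := by
      have : 2 * Real.log (1 + l) = Real.log ((1 + l)^2) := by rw [Real.log_pow]; norm_num
      rw [this]
      apply Real.log_le_log (div_pos (by linarith) (by linarith))
      rw [div_le_iff₀ (by linarith)]
      nlinarith [sq_nonneg (l - 1/2), mul_nonneg (sq_nonneg (1 + l)) (sub_nonneg.2 hlog2.le)]
    obtain ⟨F, hFE, hFc, hFT⟩ := main_ind G c x s t y d hc hx hy hys (fun i => (hst0 i).2)
      hd0 hds hdt hde β (4 * O) (5 * L) hβ0 (by linarith) (by rw [hWβ]; linarith) _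
      G.edgeFinset Finset.univ rfl (fun e he => SimpleGraph.mem_edgeFinset.1 he) hW.le
    refine ⟨F, ?_, ?_, ?_⟩
    · intro e he
      exact SimpleGraph.mem_edgeFinset.1 (hFE (by exact_mod_cast he))
    · rw [← hO, hW] at hFc
      have hmax : max (4 * O) β = 4 * O := by
        apply max_eq_left
        rw [← hβr]; nlinarith
      rw [hmax, hWβ] at hFc
      refine hFc.trans ?_
      have h1 : L * Real.log (4 * r) ≤ (2 * Real.log (1 + l)) * (2 * l) :=
        mul_le_mul hLle h4r (by linarith) (by linarith)
      have h2 := mul_le_mul_of_nonneg_right h1 hO0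
      nlinarith
    · rintro i ⟨p, q, hpp, hqp, hpq, hd⟩
      have hle : G.deleteEdges ↑F ≤ G := SimpleGraph.deleteEdges_le _
      have gen : ∀ p : (G.deleteEdges ↑F).Walk (s i) (t i), ∀ e ∈ (p.mapLe hle).edges,
          e ∈ ((G.edgeFinset \ F : Finset (Sym2 V)) : Set (Sym2 V)) := by
        intro p e he
        rw [SimpleGraph.Walk.edges_mapLe_eq_edges] at he
        have h3 := p.edges_subset_edgeSet he
        rw [SimpleGraph.edgeSet_deleteEdges] at h3
        rw [Finset.mem_coe, Finset.mem_sdiff, SimpleGraph.mem_edgeFinset]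
        exact ⟨h3.1, fun h => h3.2 (by exact_mod_cast h)⟩
      refine hFT i (Finset.mem_univ i) ⟨p.mapLe hle, q.mapLe hle,
        (SimpleGraph.Walk.isPath_mapLe hle).2 hpp, (SimpleGraph.Walk.isPath_mapLe hle).2 hqp,
        ?_, ?_, gen p, gen q⟩
      · intro h
        apply hpq
        apply SimpleGraph.Walk.ext_support
        have := congrArg SimpleGraph.Walk.support h
        simpa only [SimpleGraph.Walk.support_mapLe_eq_support] using this
      · intro w h1 h2
        rw [SimpleGraph.Walk.support_mapLe_eq_support] at h1 h2
        exact hd w h1 h2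
end

section
/- Existence of a good radius with node lengths and a node-connectivity lower bound (unit node costs): in the node-weighted region-growing setup, assume additionally that every node has unit cost (c_v = 1 for all v); that k ≥ 2 and r ≥ 1 are integers with Σ_v y_v ≤ k−1 and β = (Σ_v x_v)/r > 0; that γ > 1; that s, t ∈ S with x_t = y_t = 0 and ℓ(s;t) ≥ 1; and that every set X ⊆ S \ {s,t} whose removal leaves s and t in different connected components of the subgraph of G induced on S \ X satisfies |X| ≥ γ(k−1). Let V^x(S) = β + Σ_{v∈S} x_v. Then there exists ρ₁ ∈ [0,1) such that, growing balls around z = s, both |Γ(ρ₁)| ≤ (2γ/(√γ−1)²) · Vol(ρ₁) · ln( e·V^x(S)/Vol(ρ₁) ) · ln ln( e(r+1) ) and |Γ(ρ₁)| ≤ (2γ/(√γ−1)²) · cVol(ρ₁) · ln( e·V^x(S)/cVol(ρ₁) ) · ln ln( e(r+1) ). -/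
open scoped Classical

namespace NodeRegionGrow

variable {V : Type*}

/-- The ball `B(ρ)` (w.r.t. the distance function `g = ℓ(z;·)`). -/
noncomputable def ball (g : V → ℝ) (S : Finset V) (ρ : ℝ) : Finset V :=
  S.filter fun v => g v ≤ ρ

/-- The `x`-boundary `Γx(ρ) = {v ∈ S : ρ + y_v < ℓ(z;v) ≤ ρ + x_v + y_v}`. -/
noncomputable def gx (g : V → ℝ) (xv yv : V → ℝ) (S : Finset V) (ρ : ℝ) : Finset V :=
  S.filter fun v => ρ + yv v < g v ∧ g v ≤ ρ + xv v + yv v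

/-- The `y`-boundary `Γy(ρ) = {v ∈ S : ρ < ℓ(z;v) ≤ ρ + y_v}`. -/
noncomputable def gy (g : V → ℝ) (yv : V → ℝ) (S : Finset V) (ρ : ℝ) : Finset V :=
  S.filter fun v => ρ < g v ∧ g v ≤ ρ + yv v

/-- The neighborhood boundary
`Γ(ρ) = {v ∈ S \ B(ρ) : v is adjacent to some vertex of B(ρ)}`. -/
noncomputable def gnbr (G : SimpleGraph V) (g : V → ℝ) (S : Finset V) (ρ : ℝ) : Finset V :=
  S.filter fun v => ¬ g v ≤ ρ ∧ ∃ u ∈ ball g S ρ, G.Adj u v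

/-- `B̄(ρ) = S \ (B(ρ) ∪ Γ(ρ))`. -/
noncomputable def bbar [DecidableEq V] (G : SimpleGraph V) (g : V → ℝ) (S : Finset V)
    (ρ : ℝ) : Finset V :=
  S \ (ball g S ρ ∪ gnbr G g S ρ)

/-- The volume
`Vol(ρ) = β + Σ_{u∈B(ρ)∪Γy(ρ)} c_u x_u + Σ_{u∈Γx(ρ)} c_u (ρ - (ℓ(z;u) - x_u - y_u))`. -/
noncomputable def vol [DecidableEq V] (c xv yv : V → ℝ) (g : V → ℝ) (S : Finset V)
    (β ρ : ℝ) : ℝ :=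
  β + ∑ u ∈ ball g S ρ ∪ gy g yv S ρ, c u * xv u
    + ∑ u ∈ gx g xv yv S ρ, c u * (ρ - (g u - xv u - yv u))

/-- The complementary volume
`cVol(ρ) = β + Σ_{u∈B̄(ρ)∪Γy(ρ)} c_u x_u + Σ_{u∈Γx(ρ)} c_u (ℓ(z;u) - y_u - ρ)`. -/
noncomputable def cvol [DecidableEq V] (G : SimpleGraph V) (c xv yv : V → ℝ) (g : V → ℝ)
    (S : Finset V) (β ρ : ℝ) : ℝ :=
  β + ∑ u ∈ bbar G g S ρ ∪ gy g yv S ρ, c u * xv u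
    + ∑ u ∈ gx g xv yv S ρ, c u * (g u - yv u - ρ)


section aux

noncomputable def cl (a b ρ : ℝ) : ℝ := max 0 (min (ρ - a) b)

lemma cl_nonneg (a b ρ : ℝ) : 0 ≤ cl a b ρ := le_max_left _ _

lemma cl_le (a b ρ : ℝ) (hb : 0 ≤ b) : cl a b ρ ≤ b := max_le hb (min_le_right _ _)

lemma cl_cont (a b : ℝ) : Continuous (cl a b) := by unfold cl; fun_prop

lemma cl_deriv (a b ρ : ℝ) (hb : 0 ≤ b) :
    HasDerivWithinAt (cl a b) (if a ≤ ρ ∧ ρ < a + b then 1 else 0) (Set.Ici ρ) ρ := by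
  by_cases h1 : a ≤ ρ
  · by_cases h2 : ρ < a + b
    · rw [if_pos ⟨h1, h2⟩]
      have : HasDerivWithinAt (fun z : ℝ => z - a) 1 (Set.Ici ρ) ρ :=
        ((hasDerivAt_id ρ).sub_const a).hasDerivWithinAt
      refine this.congr_of_eventuallyEq ?_ ?_
      · have e : ∀ᶠ z in nhdsWithin ρ (Set.Ici ρ), z < a + b :=
          mem_nhdsWithin_of_mem_nhds (Iio_mem_nhds h2)
        filter_upwards [e, self_mem_nhdsWithin] with z hz hz'
        simp only [Set.mem_Ici] at hz'
        unfold cl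
        rw [min_eq_left (by linarith), max_eq_right (by linarith)]
      · unfold cl
        rw [min_eq_left (by linarith), max_eq_right (by linarith)]
    · rw [if_neg (fun h => h2 h.2)]
      push Not at h2
      refine (hasDerivWithinAt_const ρ (Set.Ici ρ) b).congr (fun z hz => ?_) ?_
      · simp only [Set.mem_Ici] at hz
        unfold cl
        rw [min_eq_right (by linarith), max_eq_right hb]
      · unfold cl
        rw [min_eq_right (by linarith), max_eq_right hb]
  · rw [if_neg (fun h => h1 h.1)]
    push Not at h1
    refine (hasDerivWithinAt_const ρ (Set.Ici ρ) 0).congr_of_eventuallyEq ?_ ?_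
    · have e : ∀ᶠ z in nhdsWithin ρ (Set.Ici ρ), z < a :=
        mem_nhdsWithin_of_mem_nhds (Iio_mem_nhds h1)
      filter_upwards [e] with z hz
      unfold cl
      rw [max_eq_left]
      exact (min_le_left _ _).trans (by linarith)
    · unfold cl
      rw [max_eq_left]
      exact (min_le_left _ _).trans (by linarith)

lemma growth (W W' : ℝ → ℝ) (hW : ContinuousOn W (Set.Icc 0 1))
    (hd : ∀ ρ ∈ Set.Ico (0 : ℝ) 1, HasDerivWithinAt W (W' ρ) (Set.Ici ρ) ρ)
    (hg : ∀ ρ ∈ Set.Ico (0 : ℝ) 1, 1 < W' ρ) : 1 < W 1 - W 0 := by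
  have key : ∀ e ∈ Set.Ico (0 : ℝ) 1, 1 - e ≤ W 1 - W e := by
    intro e he
    have := image_le_of_deriv_right_le_deriv_boundary (f := fun z => - W z) (f' := fun z => - W' z)
      (a := e) (b := 1) (hW.mono (Set.Icc_subset_Icc_left he.1)).neg
      (fun z hz => (hd z ⟨he.1.trans hz.1, hz.2⟩).neg)
      (B := fun z => - W e + (e - z)) (B' := fun _ => -1) (by simp)
      (by fun_prop)
      (fun z _ => by
        have h := (((hasDerivAt_id z).const_sub e).const_add (-W e))
        exact h.hasDerivWithinAt)
      (fun z hz => by have := hg z ⟨he.1.trans hz.1, hz.2⟩; linarith)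
      (x := 1) ⟨he.2.le, le_rfl⟩
    linarith
  have h0 : (0 : ℝ) ∈ Set.Ico (0 : ℝ) 1 := by simp
  have hs := (hasDerivWithinAt_iff_tendsto_slope' (by simp)).1
    ((hd 0 h0).mono Set.Ioi_subset_Ici_self)
  have h1 := hs.eventually (lt_mem_nhds (hg 0 h0))
  have h2 : ∀ᶠ z in nhdsWithin (0 : ℝ) (Set.Ioi 0), z < 1 :=
    mem_nhdsWithin_of_mem_nhds (Iio_mem_nhds one_pos)
  obtain ⟨e, he1, he2, he3⟩ := (h1.and (h2.and self_mem_nhdsWithin)).exists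
  replace he3 : 0 < e := he3
  rw [slope_def_field, lt_div_iff₀ (by linarith)] at he1
  have := key e ⟨he3.le, he2⟩
  linarith

lemma f_mono {U a b : ℝ} (ha : 0 < a) (hab : a ≤ b) (hb : b ≤ U) :
    a * Real.log (Real.exp 1 * U / a) ≤ b * Real.log (Real.exp 1 * U / b) := by
  have hb0 : 0 < b := by linarith
  have hU : 0 < U := by linarith
  have e : ∀ z, 0 < z → Real.log (Real.exp 1 * U / z) = 1 + Real.log (U / z) := by
    intro z hz
    rw [mul_div_assoc, Real.log_mul (Real.exp_pos 1).ne' (by positivity), Real.log_exp]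
  rw [e a ha, e b hb0]
  have h1 : Real.log (U / a) = Real.log (U / b) + Real.log (b / a) := by
    rw [← Real.log_mul (by positivity) (by positivity)]; congr 1; field_simp
  have h2 : Real.log (b / a) ≤ b / a - 1 := Real.log_le_sub_one_of_pos (by positivity)
  have h3 : 0 ≤ Real.log (U / b) := Real.log_nonneg (by rw [le_div_iff₀ hb0]; linarith)
  have h4 : a * Real.log (b / a) ≤ b - a := by
    calc a * Real.log (b / a) ≤ a * (b / a - 1) := by gcongr
      _ = b - a := by field_simp
  rw [h1]
  nlinarith [mul_nonneg (sub_nonneg.2 hab) h3]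

lemma f_big {U C : ℝ} (hU : 0 < U) (h1 : U ≤ C) (h2 : C ≤ 2 * U) :
    U / 2 ≤ C * Real.log (Real.exp 1 * U / C) := by
  have hC : 0 < C := by linarith
  have e : Real.log (Real.exp 1 * U / C) = 1 - Real.log 2 - Real.log (C / (2 * U)) := by
    have : Real.exp 1 * U / C = Real.exp 1 / 2 / (C / (2 * U)) := by field_simp
    rw [this, Real.log_div (by positivity) (by positivity),
      Real.log_div (by positivity) (by positivity), Real.log_exp]
  rw [e]
  have h3 : Real.log (C / (2 * U)) ≤ C / (2 * U) - 1 := Real.log_le_sub_one_of_pos (by positivity)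
  have h4 := Real.log_two_lt_d9
  have h5 : C * (1.3 - C / (2 * U)) ≤ C * (1 - Real.log 2 - Real.log (C / (2 * U))) := by
    apply mul_le_mul_of_nonneg_left _ hC.le
    linarith
  refine le_trans ?_ h5
  obtain ⟨q, rfl⟩ : ∃ q, C = q * U := ⟨C / U, by field_simp⟩
  have h6 : q * U / (2 * U) = q / 2 := by field_simp
  rw [h6]
  have q1 : 1 ≤ q := by nlinarith
  have q2 : q ≤ 2 := by nlinarith
  nlinarith [mul_nonneg (sub_nonneg.2 q1) (sub_nonneg.2 q2)]

lemma loglog_deriv {U : ℝ} (g : ℝ → ℝ) (g' ρ : ℝ) (hU : 0 < U) (h0 : 0 < g ρ) (h1 : g ρ ≤ U)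
    (hg : HasDerivWithinAt g g' (Set.Ici ρ) ρ) :
    HasDerivWithinAt (fun z => Real.log (Real.log (Real.exp 1 * U / g z)))
      (-(g' / (g ρ * Real.log (Real.exp 1 * U / g ρ)))) (Set.Ici ρ) ρ := by
  have hl : 0 < Real.log (Real.exp 1 * U / g ρ) := by
    apply Real.log_pos
    rw [lt_div_iff₀ h0]
    have := Real.add_one_lt_exp (one_ne_zero)
    nlinarith
  have h := ((((hasDerivWithinAt_const ρ (Set.Ici ρ) (Real.exp 1 * U)).fun_div hg h0.ne').log
    (by positivity)).log hl.ne')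
  convert h using 1
  have := Real.exp_pos 1
  field_simp
  ring

lemma loglog_bd {U β a R : ℝ} (hβ : 0 < β) (h1 : β ≤ a) (h2 : a ≤ U) (h3 : U ≤ R * β) :
    0 ≤ Real.log (Real.log (Real.exp 1 * U / a)) ∧
    Real.log (Real.log (Real.exp 1 * U / a)) ≤ Real.log (Real.log (Real.exp 1 * R)) := by
  have ha : 0 < a := by linarith
  have hl : 1 ≤ Real.log (Real.exp 1 * U / a) := by
    rw [Real.le_log_iff_exp_le (by positivity [ha.trans_le h2]), le_div_iff₀ ha]
    gcongr
  refine ⟨Real.log_nonneg hl, Real.log_le_log (by linarith) (Real.log_le_log ?_ ?_)⟩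
  · have : 0 < U := by linarith
    positivity
  · rw [div_le_iff₀ ha, mul_assoc]
    have hR : 0 ≤ R := by
      by_contra hR
      push Not at hR
      nlinarith
    gcongr
    nlinarith

end aux

section graph

variable [Fintype V] [DecidableEq V] (G : SimpleGraph V) (xv yv : V → ℝ)
    (hx : ∀ w, 0 ≤ xv w) (hyv : ∀ w, 0 ≤ yv w)

lemma step_le (hx : ∀ w, 0 ≤ xv w) (hyv : ∀ w, 0 ≤ yv w) (ℓ : V → V → ℝ)
    (hle : ∀ u v, ∀ p : G.Walk u v, p.IsPath →
      ℓ u v ≤ (p.support.tail.map (fun w => xv w + yv w)).sum)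
    (hattain : ∀ u v, G.Reachable u v → ∃ p : G.Walk u v, p.IsPath ∧
      ℓ u v = (p.support.tail.map (fun w => xv w + yv w)).sum)
    (hfar : ∀ u v, ¬ G.Reachable u v → 1 + xv v + yv v < ℓ u v)
    (s u v : V) (hu : ℓ s u < 1) (ha : G.Adj u v) : ℓ s v ≤ ℓ s u + xv v + yv v := by
  have hr : G.Reachable s u := by
    by_contra h
    have := hfar s u h
    linarith [hx u, hyv u]
  obtain ⟨p, hp, he⟩ := hattain s u hr
  have hsub : ∀ {l m : List V}, l.Sublist m → (l.map (fun w => xv w + yv w)).sum ≤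
      (m.map (fun w => xv w + yv w)).sum := by
    intro l m h
    apply (h.map _).sum_le_sum
    intro a ha
    obtain ⟨w, -, rfl⟩ := List.mem_map.1 ha
    exact add_nonneg (hx w) (hyv w)
  have h1 := hle s v (p.concat ha).bypass (SimpleGraph.Walk.bypass_isPath _)
  have h2 : (p.concat ha).support.tail = p.support.tail ++ [v] := by
    rw [SimpleGraph.Walk.support_concat, List.tail_append_of_ne_nil (SimpleGraph.Walk.support_ne_nil p)]
  have h3 : ((p.concat ha).bypass.support.tail).Sublist (p.concat ha).support.tail :=
    (SimpleGraph.Walk.support_bypass_sublist_support _).tail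
  have h4 := hsub h3
  rw [h2, List.map_append, List.sum_append, ← he] at h4
  have h5 : (List.map (fun w => xv w + yv w) [v]).sum = xv v + yv v := by simp
  linarith

lemma cut_walk (g : V → ℝ) (S : Finset V) (ρ : ℝ) {u w : V} (p : G.Walk u w)
    (hu : g u ≤ ρ) (hp : ∀ z ∈ p.support, z ∈ S ∧ z ∉ gnbr G g S ρ) : g w ≤ ρ := by
  induction p with
  | nil => exact hu
  | cons h q ih =>
    rename_i a b c
    apply ih
    · by_contra hb
      have hbS := hp b (by simp)
      apply hbS.2
      unfold gnbr
      rw [Finset.mem_filter]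
      exact ⟨hbS.1, hb, a, by
        unfold ball
        rw [Finset.mem_filter]
        exact ⟨(hp a (by simp)).1, hu⟩, h⟩
    · intro z hz
      exact hp z (by simp [hz])

lemma vol_eq (hx : ∀ w, 0 ≤ xv w) (hyv : ∀ w, 0 ≤ yv w) (c : V → ℝ) (hc : ∀ w, c w = 1)
    (g : V → ℝ) (S : Finset V) (β ρ : ℝ) :
    vol c xv yv g S β ρ = β + ∑ u ∈ S, cl (g u - xv u - yv u) (xv u) ρ := by
  have hU : ball g S ρ ∪ gy g yv S ρ = S.filter fun v => g v ≤ ρ + yv v := by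
    ext v
    have := hyv v
    simp only [ball, gy, Finset.mem_union, Finset.mem_filter]
    constructor
    · rintro (h | h)
      · exact ⟨h.1, by linarith⟩
      · exact ⟨h.1, h.2.2⟩
    · rintro ⟨h1, h2⟩
      by_cases h : g v ≤ ρ
      · exact Or.inl ⟨h1, h⟩
      · exact Or.inr ⟨h1, not_le.1 h, h2⟩
  unfold vol
  rw [hU, gx, Finset.sum_filter, Finset.sum_filter, add_assoc, ← Finset.sum_add_distrib]
  congr 1
  refine Finset.sum_congr rfl fun u _ => ?_
  have h1 := hx u
  have h2 := hyv u
  rw [hc u]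
  unfold cl
  by_cases h3 : g u ≤ ρ + yv u
  · rw [if_pos h3, if_neg (fun h => not_le.2 h.1 h3), min_eq_right (by linarith),
      max_eq_right h1]
    ring
  · rw [if_neg h3]
    push Not at h3
    by_cases h4 : g u ≤ ρ + xv u + yv u
    · rw [if_pos ⟨h3, h4⟩, min_eq_left (by linarith), max_eq_right (by linarith)]
      ring
    · rw [if_neg (fun h => h4 h.2), max_eq_left]
      · ring
      · exact (min_le_left _ _).trans (by linarith)

lemma gnbr_not_mem {g : V → ℝ} {S : Finset V} {ρ : ℝ} {u : V} (h : u ∈ gnbr G g S ρ) :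
    u ∈ S ∧ ρ < g u := by
  unfold gnbr at h
  rw [Finset.mem_filter] at h
  exact ⟨h.1, not_le.1 h.2.1⟩

lemma cvol_bds (hx : ∀ w, 0 ≤ xv w) (hyv : ∀ w, 0 ≤ yv w) (c : V → ℝ) (hc : ∀ w, c w = 1)
    (g : V → ℝ) (S : Finset V) (β ρ : ℝ)
    (hsub : ∀ v ∈ gnbr G g S ρ, g v ≤ ρ + xv v + yv v) :
    β + ∑ u ∈ S, (xv u - cl (g u - xv u - yv u) (xv u) ρ) ≤ cvol G c xv yv g S β ρ ∧
    cvol G c xv yv g S β ρ ≤ β + 2 * ∑ u ∈ S, xv u := by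
  have hU : bbar G g S ρ ∪ gy g yv S ρ =
      S.filter fun v => v ∈ bbar G g S ρ ∪ gy g yv S ρ := by
    ext v
    simp only [bbar, gy, Finset.mem_union, Finset.mem_filter, Finset.mem_sdiff]
    tauto
  have e : cvol G c xv yv g S β ρ = β + ∑ u ∈ S,
      ((if u ∈ bbar G g S ρ ∪ gy g yv S ρ then xv u else 0) +
       (if ρ + yv u < g u ∧ g u ≤ ρ + xv u + yv u then g u - yv u - ρ else 0)) := by
    unfold cvol
    rw [hU, gx, Finset.sum_filter, Finset.sum_filter, add_assoc, ← Finset.sum_add_distrib]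
    simp only [hc, one_mul]
    congr 1
    refine Finset.sum_congr rfl fun u hu => ?_
    simp [hu]
  rw [e]
  constructor
  · gcongr with u hu
    have h1 := hx u
    have h2 := hyv u
    unfold cl
    by_cases h3 : g u ≤ ρ + yv u
    · rw [min_eq_right (by linarith), max_eq_right h1]
      split_ifs <;> linarith
    · push Not at h3
      by_cases h4 : g u ≤ ρ + xv u + yv u
      · rw [if_pos (And.intro h3 h4), min_eq_left (by linarith), max_eq_right (by linarith)]
        split_ifs <;> linarith
      · have hm : u ∈ bbar G g S ρ ∪ gy g yv S ρ := by
          apply Finset.mem_union_left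
          unfold bbar
          rw [Finset.mem_sdiff, Finset.mem_union]
          refine ⟨hu, ?_⟩
          rintro (h | h)
          · unfold ball at h
            have := (Finset.mem_filter.1 h).2
            linarith
          · exact h4 (hsub u h)
        rw [if_pos hm, if_neg (fun h => h4 h.2)]
        have := le_max_left 0 (min (ρ - (g u - xv u - yv u)) (xv u))
        linarith
  · rw [Finset.mul_sum]
    gcongr with u hu
    have h1 := hx u
    split_ifs with h3 h4 h4 <;> [skip; skip; skip; skip] <;> first | linarith [h4.2] | linarith

end graph

set_option linter.unusedSectionVars false
set_option maxHeartbeats 2000000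

/-- Existence of a good radius with node lengths and a
node-connectivity lower bound (unit node costs): if every node has unit cost,
`Σ_v y_v ≤ k-1`, `β = (Σ_v x_v)/r > 0`, `γ > 1`, `s, t ∈ S` with `x_t = y_t = 0` and
`ℓ(s;t) ≥ 1`, and every vertex set `X ⊆ S \ {s,t}` whose removal separates `s` from
`t` in the subgraph induced on `S \ X` has `|X| ≥ γ(k-1)`, then there is `ρ₁ ∈ [0,1)`
(growing balls around `z = s`) such that `|Γ(ρ₁)|` satisfies both volume bounds with
the constant `2γ/(√γ-1)²`, where `V^x(S) = β + Σ_{v∈S} x_v`. -/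
theorem stmt_17 [Fintype V] [DecidableEq V] (G : SimpleGraph V)
    (c xv yv : V → ℝ)
    (hc : ∀ w, c w = 1) (hx : ∀ w, 0 ≤ xv w) (hyv : ∀ w, 0 ≤ yv w)
    (k r : ℕ) (hk : 2 ≤ k) (hr : 1 ≤ r)
    (hysum : ∑ w, yv w ≤ (k : ℝ) - 1)
    (β : ℝ) (hβ : β = (∑ w, xv w) / r) (hβpos : 0 < β)
    (γ : ℝ) (hγ : 1 < γ)
    (S : Finset V)
    (ℓ : V → V → ℝ)
    (hle : ∀ u v, ∀ p : G.Walk u v, p.IsPath →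
      ℓ u v ≤ (p.support.tail.map (fun w => xv w + yv w)).sum)
    (hattain : ∀ u v, G.Reachable u v → ∃ p : G.Walk u v, p.IsPath ∧
      ℓ u v = (p.support.tail.map (fun w => xv w + yv w)).sum)
    (hfar : ∀ u v, ¬ G.Reachable u v → 1 + xv v + yv v < ℓ u v)
    (s t : V) (hs : s ∈ S) (ht : t ∈ S)
    (hxt : xv t = 0) (hyt : yv t = 0) (hst : 1 ≤ ℓ s t)
    (hcut : ∀ X : Finset V, ↑X ⊆ (↑S : Set V) \ {s, t} →
      (¬ ∃ p : G.Walk s t, ∀ w ∈ p.support, w ∈ S ∧ w ∉ X) →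
      γ * ((k : ℝ) - 1) ≤ X.card) :
    ∃ ρ₁ ∈ Set.Ico (0 : ℝ) 1,
      (((gnbr G (ℓ s) S ρ₁).card : ℝ) ≤
        2 * γ / (Real.sqrt γ - 1) ^ 2 * vol c xv yv (ℓ s) S β ρ₁ *
          Real.log (Real.exp 1 * (β + ∑ w ∈ S, xv w) / vol c xv yv (ℓ s) S β ρ₁) *
          Real.log (Real.log (Real.exp 1 * (r + 1)))) ∧
      (((gnbr G (ℓ s) S ρ₁).card : ℝ) ≤
        2 * γ / (Real.sqrt γ - 1) ^ 2 * cvol G c xv yv (ℓ s) S β ρ₁ *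
          Real.log (Real.exp 1 * (β + ∑ w ∈ S, xv w) / cvol G c xv yv (ℓ s) S β ρ₁) *
          Real.log (Real.log (Real.exp 1 * (r + 1)))) := by
  by_contra hbad
  push Not at hbad
  set g : V → ℝ := ℓ s with hg
  set U : ℝ := β + ∑ w ∈ S, xv w with hU
  set L : ℝ := Real.log (Real.log (Real.exp 1 * (r + 1))) with hL
  have hrpos : (0 : ℝ) < r := by exact_mod_cast hr
  have hr1 : (1 : ℝ) ≤ r := by exact_mod_cast hr
  have hk1 : (0 : ℝ) < (k : ℝ) - 1 := by
    have : (2 : ℝ) ≤ k := by exact_mod_cast hk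
    linarith
  have hLpos : 0 < L := by
    apply Real.log_pos
    rw [Real.log_mul (Real.exp_pos 1).ne' (by positivity), Real.log_exp]
    have := Real.log_pos (show (1 : ℝ) < r + 1 by linarith)
    linarith
  have hSx : ∑ w ∈ S, xv w ≤ r * β := by
    rw [hβ, mul_div_cancel₀ _ hrpos.ne']
    exact Finset.sum_le_univ_sum_of_nonneg hx
  have hSx0 : 0 ≤ ∑ w ∈ S, xv w := Finset.sum_nonneg fun w _ => hx w
  have hUpos : 0 < U := by linarith
  have hUR : U ≤ ((r : ℝ) + 1) * β := by rw [hU]; linarith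
  set q : ℝ := Real.sqrt γ with hq
  have hq2 : q ^ 2 = γ := Real.sq_sqrt (by linarith)
  have hq1 : 1 < q := by
    rw [hq, Real.lt_sqrt (by norm_num)]; simpa using hγ
  set A : ℝ → ℝ := fun ρ => β + ∑ u ∈ S, cl (g u - xv u - yv u) (xv u) ρ with hA
  set Cc : ℝ → ℝ := fun ρ => β + ∑ u ∈ S, (xv u - cl (g u - xv u - yv u) (xv u) ρ) with hCc
  set Y : ℝ → ℝ := fun ρ => ∑ u ∈ S, cl (g u - yv u) (yv u) ρ with hY
  have hA1 : ∀ ρ, β ≤ A ρ := fun ρ => by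
    have : 0 ≤ ∑ u ∈ S, cl (g u - xv u - yv u) (xv u) ρ :=
      Finset.sum_nonneg fun u _ => cl_nonneg _ _ _
    simp only [hA]; linarith
  have hsum : ∀ ρ, A ρ + Cc ρ = U + β := fun ρ => by
    simp only [hA, hCc, hU, Finset.sum_sub_distrib]; ring
  have hA2 : ∀ ρ, A ρ ≤ U := fun ρ => by
    simp only [hA, hU]
    gcongr with u hu
    exact cl_le _ _ _ (hx u)
  have hC1 : ∀ ρ, β ≤ Cc ρ := fun ρ => by linarith [hsum ρ, hA2 ρ]
  have hC2 : ∀ ρ, Cc ρ ≤ U := fun ρ => by linarith [hsum ρ, hA1 ρ]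
  have hAd : ∀ ρ, HasDerivWithinAt A ((gx g xv yv S ρ).card : ℝ) (Set.Ici ρ) ρ := by
    intro ρ
    have h := (HasDerivWithinAt.fun_sum (u := S) fun u _ =>
      cl_deriv (g u - xv u - yv u) (xv u) ρ (hx u)).const_add β
    refine h.congr_deriv (Eq.symm ?_)
    rw [gx, Finset.card_filter, Nat.cast_sum]
    refine Finset.sum_congr rfl fun u _ => ?_
    rw [Nat.cast_ite, Nat.cast_one, Nat.cast_zero]
    apply if_congr _ rfl rfl
    constructor
    · rintro ⟨h1, h2⟩; constructor <;> linarith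
    · rintro ⟨h1, h2⟩; constructor <;> linarith
  have hCd : ∀ ρ, HasDerivWithinAt Cc (-((gx g xv yv S ρ).card : ℝ)) (Set.Ici ρ) ρ := by
    intro ρ
    have e : Cc = fun z => (U + β) - A z := by
      funext z; linarith [hsum z]
    rw [e]
    exact (hAd ρ).const_sub _
  have hYd : ∀ ρ, HasDerivWithinAt Y ((gy g yv S ρ).card : ℝ) (Set.Ici ρ) ρ := by
    intro ρ
    have h := (HasDerivWithinAt.fun_sum (u := S) fun u _ =>
      cl_deriv (g u - yv u) (yv u) ρ (hyv u))
    refine h.congr_deriv (Eq.symm ?_)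
    rw [gy, Finset.card_filter, Nat.cast_sum]
    refine Finset.sum_congr rfl fun u _ => ?_
    rw [Nat.cast_ite, Nat.cast_one, Nat.cast_zero]
    apply if_congr _ rfl rfl
    constructor
    · rintro ⟨h1, h2⟩; constructor <;> linarith
    · rintro ⟨h1, h2⟩; constructor <;> linarith
  have hAc : Continuous A := by
    simp only [hA]
    exact continuous_const.add (continuous_finsetSum _ fun u _ => cl_cont _ _)
  have hCcont : Continuous Cc := by
    have e : Cc = fun z => (U + β) - A z := by
      funext z; linarith [hsum z]
    rw [e]; fun_prop
  have hYc : Continuous Y := continuous_finsetSum _ fun u _ => cl_cont _ _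
  set a : ℝ := 1 - 1 / q with ha
  have hapos : 0 < a := by
    rw [ha, sub_pos, div_lt_one (by linarith)]; exact hq1
  have hlogge : ∀ z, β ≤ z → z ≤ U → 1 ≤ Real.log (Real.exp 1 * U / z) := by
    intro z h1 h2
    have hz : 0 < z := by linarith
    rw [Real.le_log_iff_exp_le (by positivity), le_div_iff₀ hz]
    gcongr
  have hfpos : ∀ z, β ≤ z → z ≤ U → 0 < z * Real.log (Real.exp 1 * U / z) := by
    intro z h1 h2
    have := hlogge z h1 h2
    have : 0 < z := by linarith
    positivity
  have hfU : ∀ z, β ≤ z → z ≤ U → z * Real.log (Real.exp 1 * U / z) ≤ U := by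
    intro z h1 h2
    have h := f_mono (U := U) (a := z) (b := U) (by linarith) h2 le_rfl
    have h' : Real.exp 1 * U / U = Real.exp 1 := by field_simp
    rwa [h', Real.log_exp, mul_one] at h
  set W : ℝ → ℝ := fun ρ => a / (2 * L) *
    (Real.log (Real.log (Real.exp 1 * U / Cc ρ)) - Real.log (Real.log (Real.exp 1 * U / A ρ)))
    + Y ρ / (q * ((k : ℝ) - 1)) with hW
  have hll : ∀ h : ℝ → ℝ, Continuous h → (∀ ρ, β ≤ h ρ) → (∀ ρ, h ρ ≤ U) →
      Continuous fun ρ => Real.log (Real.log (Real.exp 1 * U / h ρ)) := by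
    intro h hc h1 h2
    have p1 : ∀ ρ, 0 < h ρ := fun ρ => by linarith [h1 ρ]
    refine ((continuous_const.div hc fun ρ => (p1 ρ).ne').log fun ρ => ?_).log fun ρ => ?_
    · have := p1 ρ
      exact (show 0 < Real.exp 1 * U / h ρ by positivity).ne'
    · have := hlogge _ (h1 ρ) (h2 ρ)
      exact (show 0 < Real.log (Real.exp 1 * U / h ρ) by linarith).ne'
  have hWc : Continuous W :=
    (continuous_const.mul ((hll Cc hCcont hC1 hC2).sub (hll A hAc hA1 hA2))).add
      (hYc.div_const _)
  have hss : g s ≤ 0 := by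
    have := hle s s SimpleGraph.Walk.nil (by simp)
    simpa using this
  have hmain := growth W (fun ρ => a / (2 * L) *
      (-(-((gx g xv yv S ρ).card : ℝ) / (Cc ρ * Real.log (Real.exp 1 * U / Cc ρ))) -
       -(((gx g xv yv S ρ).card : ℝ) / (A ρ * Real.log (Real.exp 1 * U / A ρ))))
      + ((gy g yv S ρ).card : ℝ) / (q * ((k : ℝ) - 1))) hWc.continuousOn ?_ ?_
  · -- upper bound
    have hb := fun ρ => loglog_bd hβpos (hA1 ρ) (hA2 ρ) hUR
    have hb' := fun ρ => loglog_bd hβpos (hC1 ρ) (hC2 ρ) hUR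
    have hY0 : 0 ≤ Y 0 := Finset.sum_nonneg fun u _ => cl_nonneg _ _ _
    have hY1 : Y 1 ≤ (k : ℝ) - 1 := by
      refine le_trans ?_ hysum
      refine le_trans (Finset.sum_le_sum fun u _ => cl_le _ _ _ (hyv u)) ?_
      exact Finset.sum_le_univ_sum_of_nonneg hyv
    have e : W 1 - W 0 = a / (2 * L) *
      ((Real.log (Real.log (Real.exp 1 * U / Cc 1)) - Real.log (Real.log (Real.exp 1 * U / A 1)))
      - (Real.log (Real.log (Real.exp 1 * U / Cc 0)) - Real.log (Real.log (Real.exp 1 * U / A 0))))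
      + (Y 1 - Y 0) / (q * ((k : ℝ) - 1)) := by
      simp only [hW]; ring
    have h1 : a / (2 * L) *
      ((Real.log (Real.log (Real.exp 1 * U / Cc 1)) - Real.log (Real.log (Real.exp 1 * U / A 1)))
      - (Real.log (Real.log (Real.exp 1 * U / Cc 0)) - Real.log (Real.log (Real.exp 1 * U / A 0))))
      ≤ a / (2 * L) * (2 * L) := by
      apply mul_le_mul_of_nonneg_left _ (by positivity)
      have := hb 1
      have := hb 0
      have := hb' 1
      have := hb' 0
      linarith
    have h2 : a / (2 * L) * (2 * L) = a := by field_simp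
    have hq0 : 0 < q := by linarith
    have h3 : (Y 1 - Y 0) / (q * ((k : ℝ) - 1)) ≤ 1 / q := by
      rw [div_le_div_iff₀ (by positivity) hq0]
      nlinarith
    linarith
  · intro ρ hρ
    have d1 := loglog_deriv A _ ρ hUpos (by linarith [hA1 ρ]) (hA2 ρ) (hAd ρ)
    have d2 := loglog_deriv Cc _ ρ hUpos (by linarith [hC1 ρ]) (hC2 ρ) (hCd ρ)
    exact ((d2.fun_sub d1).const_mul _).fun_add ((hYd ρ).div_const _)
  · intro ρ hρ
    have hstep : ∀ v ∈ gnbr G g S ρ, g v ≤ ρ + xv v + yv v := by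
      intro v hv
      unfold gnbr ball at hv
      obtain ⟨hvS, -, u, hu, huv⟩ := Finset.mem_filter.1 hv
      have hu' := (Finset.mem_filter.1 hu).2
      have := step_le G xv yv hx hyv ℓ hle hattain hfar s u v (lt_of_le_of_lt hu' hρ.2) huv
      linarith
    have hn1 : γ * ((k : ℝ) - 1) ≤ ((gnbr G g S ρ).card : ℝ) := by
      apply hcut
      · intro v hv
        have hv' : v ∈ gnbr G g S ρ := hv
        obtain ⟨h1, h2⟩ := gnbr_not_mem G hv'
        refine ⟨h1, ?_⟩
        rintro (h | h)
        · rw [h] at h2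
          linarith [hρ.1]
        · have h : v = t := h
          have := hstep v hv'
          rw [h] at this h2
          rw [hxt, hyt] at this
          linarith
      · rintro ⟨p, hp⟩
        have := cut_walk G g S ρ p (hss.trans hρ.1) hp
        linarith [hρ.2]
    have hn2 : ((gnbr G g S ρ).card : ℝ) ≤ (gx g xv yv S ρ).card + (gy g yv S ρ).card := by
      have hsub : gnbr G g S ρ ⊆ gx g xv yv S ρ ∪ gy g yv S ρ := by
        intro v hv
        have h1 := gnbr_not_mem G hv
        have h2 := hstep v hv
        rw [Finset.mem_union, gx, gy, Finset.mem_filter, Finset.mem_filter]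
        by_cases h : g v ≤ ρ + yv v
        · exact Or.inr ⟨h1.1, h1.2, h⟩
        · exact Or.inl ⟨h1.1, not_le.1 h, h2⟩
      have := (Finset.card_le_card hsub).trans (Finset.card_union_le _ _)
      exact_mod_cast this
    have hbd := hbad ρ hρ
    rw [vol_eq xv yv hx hyv c hc g S β ρ] at hbd
    change _ ≤ _ * A ρ * Real.log (_ / A ρ) * _ → _ at hbd
    obtain ⟨hv1, hv2⟩ := cvol_bds G xv yv hx hyv c hc g S β ρ hstep
    change Cc ρ ≤ _ at hv1
    set C := cvol G c xv yv g S β ρ with hCdef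
    set fA := A ρ * Real.log (Real.exp 1 * U / A ρ) with hfA
    set fC := Cc ρ * Real.log (Real.exp 1 * U / Cc ρ) with hfC
    have pA : 0 < fA := hfpos _ (hA1 ρ) (hA2 ρ)
    have pC : 0 < fC := hfpos _ (hC1 ρ) (hC2 ρ)
    have uA : fA ≤ U := hfU _ (hA1 ρ) (hA2 ρ)
    have uC : fC ≤ U := hfU _ (hC1 ρ) (hC2 ρ)
    set n : ℝ := ((gnbr G g S ρ).card : ℝ) with hn
    set nx : ℝ := ((gx g xv yv S ρ).card : ℝ) with hnx
    set ny : ℝ := ((gy g yv S ρ).card : ℝ) with hny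
    have hnx0 : 0 ≤ nx := Nat.cast_nonneg _
    have hny0 : 0 ≤ ny := Nat.cast_nonneg _
    set K : ℝ := 2 * γ / (q - 1) ^ 2 with hK
    have hKpos : 0 < K := by
      have : 0 < q - 1 := by linarith
      positivity
    have hq0 : 0 < q := by linarith
    have haK : a ^ 2 * K = 2 := by
      have : q - 1 ≠ 0 := by linarith
      rw [hK, ha, ← hq2]
      field_simp
    have hkey : K * L < n * (1 / fA + 1 / fC) := by
      have hn0 : 0 < n := lt_of_lt_of_le (by positivity) hn1
      by_cases h : n ≤ K * A ρ * Real.log (Real.exp 1 * U / A ρ) * L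
      · have h' := hbd h
        have hCf : 1 ≤ (C * Real.log (Real.exp 1 * U / C)) * (1 / fA + 1 / fC) := by
          by_cases hCU : C ≤ U
          · have h1 : fC ≤ C * Real.log (Real.exp 1 * U / C) :=
              f_mono (by linarith [hC1 ρ]) hv1 hCU
            calc (1 : ℝ) = fC * (1 / fC) := by field_simp
              _ ≤ fC * (1 / fA + 1 / fC) := by
                gcongr
                have : 0 < 1 / fA := by positivity
                linarith
              _ ≤ _ := by gcongr
          · have h1 : U / 2 ≤ C * Real.log (Real.exp 1 * U / C) :=
              f_big hUpos (not_le.1 hCU).le (by linarith)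
            calc (1 : ℝ) = U / 2 * (1 / U + 1 / U) := by field_simp; norm_num
              _ ≤ U / 2 * (1 / fA + 1 / fC) := by gcongr
              _ ≤ _ := by gcongr
        have hs0 : 0 < 1 / fA + 1 / fC := by positivity
        calc K * L = K * L * 1 := by ring
          _ ≤ K * L * ((C * Real.log (Real.exp 1 * U / C)) * (1 / fA + 1 / fC)) := by gcongr
          _ = (K * C * Real.log (Real.exp 1 * U / C) * L) * (1 / fA + 1 / fC) := by ring
          _ < _ := by gcongr
      · push Not at h
        have h1 : K * L * fA < n := by
          refine lt_of_eq_of_lt ?_ h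
          rw [hfA]; ring
        have h2 : K * L < n * (1 / fA) := by
          rw [mul_one_div, lt_div_iff₀ pA]; exact h1
        have : 0 < n * (1 / fC) := by positivity
        rw [mul_add]; linarith
    have e : a / (2 * L) * (-(-nx / fC) - -(nx / fA)) + ny / (q * ((k : ℝ) - 1)) =
      a / (2 * L) * (nx * (1 / fA + 1 / fC)) + ny / (q * ((k : ℝ) - 1)) := by ring
    rw [e]
    by_cases hD : n < q * ny
    · have h1 : 1 < ny / (q * ((k : ℝ) - 1)) := by
        rw [lt_div_iff₀ (by positivity)]
        have : q * (q * ((k : ℝ) - 1)) < q * ny := by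
          rw [← hq2] at hn1
          nlinarith
        have := lt_of_mul_lt_mul_left this hq0.le
        linarith
      have h2 : 0 ≤ a / (2 * L) * (nx * (1 / fA + 1 / fC)) := by positivity
      linarith
    · push Not at hD
      have h1 : a * n ≤ nx := by
        have : ny ≤ n / q := by rw [le_div_iff₀ hq0]; linarith
        have e2 : a * n = n - n / q := by rw [ha]; ring
        linarith
      have h2 : 0 ≤ ny / (q * ((k : ℝ) - 1)) := by positivity
      have h3 : 1 < a / (2 * L) * (nx * (1 / fA + 1 / fC)) := by
        calc (1 : ℝ) = a / (2 * L) * (a * (K * L)) := by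
              field_simp; linarith
          _ < a / (2 * L) * (a * (n * (1 / fA + 1 / fC))) := by gcongr
          _ = a / (2 * L) * ((a * n) * (1 / fA + 1 / fC)) := by ring
          _ ≤ _ := by gcongr
      linarith

end NodeRegionGrow
end
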